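/- Let K be an algebraically closed field of characteristic 0, R = K[x1,…,x7], and let 𝔞 ⊆ R be the ideal generated by the 32 polynomials listed in the context. Then the 16-dimensional K-algebra R/𝔞 is NOT smoothable: there is no commutative K[[t]]-algebra B that is free of rank 16 as a K[[t]]-module with B/(t)B isomorphic to R/𝔞 as a K-algebra and with B ⊗_{K[[t]]} K((t)) étale over K((t)). -/

import Mathlib

set_option maxHeartbeats 4000000
set_option maxRecDepth 4000

open MvPolynomial

open TensorProduct in
/-- A commutative `K`-algebra `A` (of dimension `d`) is *smoothable* if there is a commutative
`K[[t]]`-algebra `B`, free of rank `d` as a `K[[t]]`-module, with `B/(t)B ≅ A` as a `K`-algebra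
and `B ⊗_{K[[t]]} K((t))` étale over the Laurent series field `K((t))`. -/
def IsSmoothable (K : Type) [Field K] (A : Type) [CommRing A] [Algebra K A] (d : ℕ) : Prop :=
  ∃ (B : Type) (_ : CommRing B) (_ : Algebra (PowerSeries K) B) (_ : Algebra K B)
    (_ : IsScalarTower K (PowerSeries K) B),
    Module.Free (PowerSeries K) B ∧
    Module.finrank (PowerSeries K) B = d ∧
    Nonempty ((B ⧸ Ideal.span {(algebraMap (PowerSeries K) B) PowerSeries.X}) ≃ₐ[K] A) ∧
    Algebra.Etale (LaurentSeries K) ((LaurentSeries K) ⊗[PowerSeries K] B)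

/-- The 32 generators of the ideal `𝔞 ⊆ K[x₁,…,x₇]` (here `x_i` is `X (i-1)`). -/
noncomputable def aGens (K : Type) [Field K] : Set (MvPolynomial (Fin 7) K) :=
  {    X 6 ^ 2 - (-3 * X 0 ^ 3 + 126 * X 0 ^ 2 - 3 * (X 0 * X 1) - 2 * (X 0 * X 2)
      + X 0 * X 3 - 3 * (X 1 * X 2) + 2 * X 2 ^ 2),
    X 5 * X 6 - (-(X 0 ^ 3) + 270 * X 0 ^ 2 - 3 * (X 0 * X 1) - 3 * (X 0 * X 2)
      - X 0 * X 3 - 2 * X 1 ^ 2 - X 1 * X 2 - X 2 ^ 2),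
    X 4 * X 6 - (-209 * X 0 ^ 2 + X 0 * X 1 - 2 * (X 0 * X 2) - X 0 * X 3
      - 2 * X 1 ^ 2 - X 1 * X 2 - 2 * X 2 ^ 2),
    X 3 * X 6 - (X 0 ^ 3 - 60 * X 0 ^ 2 - 3 * (X 0 * X 1) - X 0 * X 2 - X 0 * X 3
      + X 1 ^ 2 - 2 * (X 1 * X 2) - X 2 ^ 2),
    X 2 * X 6 - (-2 * X 0 ^ 3 + 28 * X 0 ^ 2 - X 0 * X 1 + X 0 * X 2 - 2 * X 1 ^ 2
      + 2 * (X 1 * X 2) + 2 * X 2 ^ 2),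
    X 1 * X 6 - (-(X 0 ^ 3) - 67 * X 0 ^ 2 - 2 * (X 0 * X 1) - 3 * (X 0 * X 2)
      - 2 * (X 0 * X 3) + 2 * X 1 ^ 2 - 2 * (X 1 * X 2) - 3 * X 2 ^ 2),
    X 0 * X 6 - (-2 * X 0 ^ 3 + X 0 ^ 2 - 2 * (X 0 * X 1) + X 0 * X 2 - X 0 * X 3
      - X 2 ^ 2),
    X 5 ^ 2 - (X 0 ^ 3 + 469 * X 0 ^ 2 - 2 * (X 0 * X 1) - X 0 * X 2 - 3 * (X 0 * X 3)
      + 2 * X 2 ^ 2),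
    X 4 * X 5 - (X 0 ^ 3 - 412 * X 0 ^ 2 - 2 * (X 0 * X 2) - 3 * X 2 ^ 2),
    X 3 * X 5 - (-61 * X 0 ^ 2 + 2 * (X 0 * X 1) - 3 * (X 0 * X 2) - 3 * (X 0 * X 3)
      - X 1 ^ 2 - 2 * (X 1 * X 2) - 2 * X 2 ^ 2),
    X 2 * X 5 - (2 * X 0 ^ 3 + 29 * X 0 ^ 2 + X 0 * X 1 - 2 * (X 0 * X 2) - X 0 * X 3
      - 3 * X 2 ^ 2),
    X 1 * X 5 - (-(X 0 ^ 3) - 61 * X 0 ^ 2 - 2 * (X 0 * X 1) + X 0 * X 2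
      + 2 * (X 0 * X 3) - 2 * X 1 ^ 2 - 3 * (X 1 * X 2) + 2 * X 2 ^ 2),
    X 0 * X 5 - (X 0 ^ 3 + 2 * X 0 ^ 2 - X 0 * X 1 + 2 * X 1 ^ 2),
    X 4 ^ 2 - (2 * X 0 ^ 3 + 342 * X 0 ^ 2 - 2 * (X 0 * X 1) - X 0 * X 2 + X 1 ^ 2
      - 3 * (X 1 * X 2) - 2 * X 2 ^ 2),
    X 3 * X 4 - (X 0 ^ 3 + 55 * X 0 ^ 2 - 2 * (X 0 * X 1) - 2 * (X 0 * X 2)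
      - 3 * (X 0 * X 3) - X 1 ^ 2 - X 2 ^ 2),
    X 2 * X 4 - (-2 * X 0 ^ 3 - 23 * X 0 ^ 2 - 3 * (X 0 * X 1) - 3 * (X 0 * X 2)
      - 3 * (X 0 * X 3) - 2 * X 1 ^ 2 - X 1 * X 2 + 2 * X 2 ^ 2),
    X 1 * X 4 - (-(X 0 ^ 3) + 69 * X 0 ^ 2 - X 0 * X 1 - 2 * (X 0 * X 2)
      - 3 * (X 0 * X 3) - 3 * X 1 ^ 2 - 2 * (X 1 * X 2) - 2 * X 2 ^ 2),
    X 0 * X 4 - (-3 * X 0 ^ 3 + X 0 ^ 2 - 2 * (X 0 * X 1) + X 0 * X 2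
      - 2 * (X 0 * X 3) - 3 * X 1 ^ 2 + 2 * (X 1 * X 2) - 3 * X 2 ^ 2),
    X 3 ^ 2 - (10 * X 0 ^ 2 + 2 * (X 0 * X 1) - 3 * (X 0 * X 2) - 3 * (X 1 * X 2)
      - X 2 ^ 2),
    X 2 * X 3 - (X 0 ^ 3 + 19 * X 0 ^ 2 + 2 * (X 0 * X 1) + 2 * (X 0 * X 3)
      - 2 * X 1 ^ 2 - 3 * (X 1 * X 2)),
    X 1 * X 3 - (X 0 ^ 3 + 13 * X 0 ^ 2 - X 0 * X 1 + 2 * (X 1 * X 2)),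
    X 0 ^ 2 * X 3 + 3 * X 0 ^ 3,
    X 2 ^ 3 - X 0 ^ 3,
    X 1 * X 2 ^ 2 + 3 * X 0 ^ 3,
    X 0 * X 2 ^ 2 - X 0 ^ 3,
    X 1 ^ 2 * X 2 - 9 * X 0 ^ 3,
    X 0 * X 1 * X 2 + 3 * X 0 ^ 3,
    X 0 ^ 2 * X 2 - X 0 ^ 3,
    X 1 ^ 3 + 27 * X 0 ^ 3,
    X 0 * X 1 ^ 2 - 9 * X 0 ^ 3,
    X 0 ^ 2 * X 1 + 3 * X 0 ^ 3,
    X 0 ^ 4 + X 0 ^ 3 }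

namespace SpanningCheck

/-- The natural number whose base-`2 ^ W` digits are the entries of the list. -/
def pack (W : ℕ) : List ℕ → ℕ
  | [] => 0
  | r :: rs => r + 2 ^ W * pack W rs

/-- Function application, written so that evaluation reduces the argument to a numeral first. -/
def force {α : Type} (f : ℕ → α) (n : ℕ) : α :=
  Nat.rec (motive := fun _ => α) (f 0) (fun k _ => f (Nat.succ k)) n

theorem force_eq {α : Type} (f : ℕ → α) (n : ℕ) : force f n = f n := by
  cases n <;> rfl

/-- The first digit of `M` in base `2 ^ W` whose position is that of the lowest set bit of `D`. -/
def pivot (W D M : ℕ) : ℕ := M / (((D ^^^ (D - 1)) + 1) / 2) % 2 ^ W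

/-- Eliminate the variable carried by the lowest bit of each row of the packed matrix `M`. -/
def elimStep (W L : ℕ) (next : ℕ → Bool) (M : ℕ) : Bool :=
  force (fun D => force (fun p => bif p % 2 == 1 then force next ((M ^^^ D * p) / 2) else false)
    (pivot W D M)) (M &&& L)

/-- Gaussian elimination over the field with two elements on the packed matrix `M`: checks that
the first `n` columns are linearly independent. -/
def elimCheck (W L n : ℕ) : ℕ → Bool :=
  Nat.rec (fun _ => true) (fun _ next => elimStep W L next) n

/-- The value of the linear form over `ZMod 2` with coefficients the bits of `r`. -/
def bitEval (u : ℕ → ZMod 2) (n r : ℕ) : ZMod 2 :=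
  ∑ c ∈ Finset.range n, if r.testBit c then u c else 0

theorem bitEval_xor (u : ℕ → ZMod 2) (n r s : ℕ) :
    bitEval u n (r ^^^ s) = bitEval u n r + bitEval u n s := by
  unfold bitEval
  rw [← Finset.sum_add_distrib]
  refine Finset.sum_congr rfl fun c _ => ?_
  rw [Nat.testBit_xor]
  cases r.testBit c <;> cases s.testBit c <;> simp [CharTwo.add_self_eq_zero]

theorem bitEval_zero (u : ℕ → ZMod 2) (n : ℕ) : bitEval u n 0 = 0 := by
  simp [bitEval]

theorem bitEval_one_shiftLeft (u : ℕ → ZMod 2) {n c : ℕ} (hc : c < n) :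
    bitEval u n (1 <<< c) = u c := by
  unfold bitEval
  rw [Finset.sum_eq_single_of_mem c (Finset.mem_range.2 hc)]
  · simp
  · intro b _ hb
    simp [Nat.one_shiftLeft, hb.symm]

theorem bitEval_bit_shiftLeft (u : ℕ → ZMod 2) {n c : ℕ} (m : ℕ) (hc : c < n) :
    bitEval u n ((m % 2) <<< c) = (m : ZMod 2) * u c := by
  rcases Nat.mod_two_eq_zero_or_one m with h | h
  · have : (m : ZMod 2) = 0 := by
      rw [← Nat.cast_zero]; exact (ZMod.natCast_eq_natCast_iff' _ _ _).2 h
    simp [h, this, bitEval_zero]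
  · have : (m : ZMod 2) = 1 := by
      rw [← Nat.cast_one]; exact (ZMod.natCast_eq_natCast_iff' _ _ _).2 h
    rw [h, this, bitEval_one_shiftLeft u hc, one_mul]

theorem bitEval_succ (u : ℕ → ZMod 2) (n r : ℕ) :
    bitEval u (n + 1) r = (if r % 2 = 1 then u 0 else 0)
      + bitEval (fun c => u (c + 1)) n (r / 2) := by
  unfold bitEval
  rw [Finset.sum_range_succ', add_comm]
  simp [Nat.testBit_succ, Nat.testBit_zero]

theorem add_two_pow_mul_and {W a b : ℕ} (ha : a < 2 ^ W) (hb : b < 2 ^ W) (A B : ℕ) :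
    (a + 2 ^ W * A) &&& (b + 2 ^ W * B) = (a &&& b) + 2 ^ W * (A &&& B) := by
  rw [← Nat.mod_add_div ((a + 2 ^ W * A) &&& (b + 2 ^ W * B)) (2 ^ W), Nat.and_mod_two_pow,
    Nat.and_div_two_pow]
  simp [Nat.add_mul_div_left, Nat.mod_eq_of_lt, Nat.div_eq_of_lt, ha, hb]

theorem add_two_pow_mul_xor {W a b : ℕ} (ha : a < 2 ^ W) (hb : b < 2 ^ W) (A B : ℕ) :
    (a + 2 ^ W * A) ^^^ (b + 2 ^ W * B) = (a ^^^ b) + 2 ^ W * (A ^^^ B) := by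
  rw [← Nat.mod_add_div ((a + 2 ^ W * A) ^^^ (b + 2 ^ W * B)) (2 ^ W), Nat.xor_mod_two_pow,
    Nat.xor_div_two_pow]
  simp [Nat.add_mul_div_left, Nat.mod_eq_of_lt, Nat.div_eq_of_lt, ha, hb]

theorem xor_mod_two_mul_mod_two (r : ℕ) {p : ℕ} (hp : p % 2 = 1) :
    (r ^^^ r % 2 * p) % 2 = 0 := by
  have h := Nat.xor_mod_two_pow (a := r) (b := r % 2 * p) (n := 1)
  rw [pow_one, Nat.mul_mod, hp, Nat.mod_mod, mul_one, Nat.mod_mod, Nat.xor_self] at h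
  exact h

section

variable {W : ℕ}

theorem pack_and_pack_one (hW : 1 ≤ W) {rs : List ℕ} (h : ∀ r ∈ rs, r < 2 ^ W) :
    pack W rs &&& pack W (rs.map fun _ => 1) = pack W (rs.map (· % 2)) := by
  induction rs with
  | nil => simp [pack]
  | cons r rs ih =>
    simp only [List.map_cons, pack]
    rw [add_two_pow_mul_and (h r (by simp)) (Nat.one_lt_two_pow (by omega)),
      ih fun r hr => h r (by simp [hr]), Nat.and_one_is_mod]

theorem pack_xor_mul {rs : List ℕ} (h : ∀ r ∈ rs, r < 2 ^ W) {p : ℕ}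
    (hp : p < 2 ^ W) (hp1 : p % 2 = 1) :
    (pack W rs ^^^ pack W (rs.map (· % 2)) * p) / 2
      = pack W (rs.map fun r => (r ^^^ r % 2 * p) / 2) := by
  suffices pack W rs ^^^ pack W (rs.map (· % 2)) * p
      = 2 * pack W (rs.map fun r => (r ^^^ r % 2 * p) / 2) by omega
  induction rs with
  | nil => simp [pack]
  | cons r rs ih =>
    simp only [List.map_cons, pack]
    have hlt : r % 2 * p < 2 ^ W := by
      rcases Nat.mod_two_eq_zero_or_one r with h | h <;> simp [h, hp]
    rw [add_mul, mul_assoc, add_two_pow_mul_xor (h r (by simp)) hlt,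
      ih fun r hr => h r (by simp [hr])]
    have heven := xor_mod_two_mul_mod_two r hp1
    have : r ^^^ r % 2 * p = 2 * ((r ^^^ r % 2 * p) / 2) := by omega
    rw [mul_add, ← this]
    ring

theorem pivot_mem (hW : 1 ≤ W) {rs : List ℕ} (h : ∀ r ∈ rs, r < 2 ^ W)
    (hp : pivot W (pack W (rs.map (· % 2))) (pack W rs) % 2 = 1) :
    pivot W (pack W (rs.map (· % 2))) (pack W rs) ∈ rs := by
  induction rs with
  | nil => simp [pivot, pack] at hp
  | cons r rs ih =>
    specialize ih fun r hr => h r (by simp [hr])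
    have hr := h r (by simp)
    have h1 : 1 < 2 ^ W := Nat.one_lt_two_pow (by omega)
    simp only [List.map_cons, pack] at hp ⊢
    generalize pack W (rs.map (· % 2)) = E at *
    generalize pack W rs = R at *
    have hdiv : (r + 2 ^ W * R) / 2 ^ W = R := by
      rw [Nat.add_mul_div_left _ _ (by positivity), Nat.div_eq_of_lt hr, zero_add]
    rcases Nat.mod_two_eq_zero_or_one r with h0 | h0
    · rw [h0, zero_add] at hp ⊢
      have key : pivot W (2 ^ W * E) (r + 2 ^ W * R) = pivot W E R := by
        rcases E with _ | E
        · simp [pivot]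
        · have hd : 2 ^ W * (E + 1) - 1 = (2 ^ W - 1) + 2 ^ W * E := by
            rw [mul_add]; omega
          have hx := add_two_pow_mul_xor (W := W) (a := 0) (b := 2 ^ W - 1) (by omega) (by omega)
            (E + 1) E
          rw [zero_add, Nat.zero_xor] at hx
          have hodd : ((E + 1) ^^^ E) % 2 = 1 := by
            have := Nat.xor_mod_two_pow (a := E + 1) (b := E) (n := 1)
            rw [pow_one] at this
            rcases Nat.mod_two_eq_zero_or_one E with h | h
            · rw [h, show (E + 1) % 2 = 1 by omega] at this; simpa using this
            · rw [h, show (E + 1) % 2 = 0 by omega] at this; simpa using this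
          unfold pivot
          rw [hd, hx, Nat.add_sub_cancel]
          generalize (E + 1) ^^^ E = x at *
          have : (2 ^ W - 1 + 2 ^ W * x + 1) / 2 = 2 ^ W * ((x + 1) / 2) := by
            obtain ⟨y, rfl⟩ : ∃ y, x = 2 * y + 1 := ⟨x / 2, by omega⟩
            have : 2 ^ W - 1 + 2 ^ W * (2 * y + 1) + 1 = 2 * (2 ^ W * (y + 1)) := by
              zify [h1.le]; ring
            rw [this, show (2 * y + 1 + 1) / 2 = y + 1 by omega]
            omega
          rw [this, ← Nat.div_div_eq_div_mul, hdiv]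
      rw [key] at hp ⊢
      exact List.mem_cons_of_mem _ (ih hp)
    · have hx := add_two_pow_mul_xor (W := W) (a := 1) (b := 0) (by omega) (by omega) E E
      have : pivot W (r % 2 + 2 ^ W * E) (r + 2 ^ W * R) = r := by
        rw [h0]
        unfold pivot
        rw [zero_add] at hx
        rw [Nat.add_sub_cancel_left, hx]
        simp [Nat.mod_eq_of_lt hr]
      rw [this]
      simp

theorem eq_zero_of_elimCheck (hW : 1 ≤ W) (n : ℕ) (u : ℕ → ZMod 2) (rs : List ℕ)
    (hlt : ∀ r ∈ rs, r < 2 ^ W) (hrs : ∀ r ∈ rs, bitEval u n r = 0)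
    (h : elimCheck W (pack W (rs.map fun _ => 1)) n (pack W rs) = true) :
    ∀ c < n, u c = 0 := by
  induction n generalizing u rs with
  | zero => intro c hc; omega
  | succ n ih =>
    change elimStep W _ (elimCheck W _ n) _ = true at h
    simp only [elimStep, force_eq, pack_and_pack_one hW hlt] at h
    generalize hp : pivot W (pack W (rs.map (· % 2))) (pack W rs) = p at h
    rcases Nat.mod_two_eq_zero_or_one p with hp1 | hp1
    · simp [hp1] at h
    have hmem : p ∈ rs := hp ▸ pivot_mem hW hlt (hp ▸ hp1)
    rw [hp1, pack_xor_mul hlt (hlt p hmem) hp1] at h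
    have hval : ∀ r ∈ rs, bitEval (fun c => u (c + 1)) n ((r ^^^ r % 2 * p) / 2) = 0 := by
      intro r hr
      have hx : bitEval u (n + 1) (r ^^^ r % 2 * p) = 0 := by
        rw [bitEval_xor, hrs r hr]
        rcases Nat.mod_two_eq_zero_or_one r with h | h <;>
          simp [h, bitEval_zero, hrs p hmem]
      rw [bitEval_succ, xor_mod_two_mul_mod_two r hp1] at hx
      simpa using hx
    have hsucc := ih (fun c => u (c + 1)) (rs.map fun r => (r ^^^ r % 2 * p) / 2)
      (by
        intro _ hr'
        obtain ⟨r, hr, rfl⟩ := List.mem_map.1 hr'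
        have : r ^^^ r % 2 * p < 2 ^ W := Nat.xor_lt_two_pow (hlt r hr) (by
          rcases Nat.mod_two_eq_zero_or_one r with h | h <;> simp [h, hlt p hmem])
        omega)
      (by
        intro _ hmem
        obtain ⟨r, hr, rfl⟩ := List.mem_map.1 hmem
        exact hval r hr)
      (by simpa [Function.comp_def] using h)
    rintro (_ | c) hc
    · have := hrs p hmem
      rw [bitEval_succ, if_pos hp1] at this
      have h0 : bitEval (fun c => u (c + 1)) n (p / 2) = 0 :=
        Finset.sum_eq_zero fun c hc => by
          simp [hsucc c (Finset.mem_range.1 hc)]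
      rwa [h0, add_zero] at this
    · exact hsucc c (by omega)

end

end SpanningCheck

/-- The quadratic part of the structure constants of the local component: the product
`x i * x j` equals `∑ s, quad i j s • (x (wFst s) * x (wSnd s))`. -/
def quad : Fin 7 → Fin 7 → Fin 7 → ℤ :=
  ![![![1,0,0,0,0,0,0],![0,1,0,0,0,0,0],![0,0,1,0,0,0,0],![0,0,0,1,0,0,0],
      ![1,-2,1,-2,-3,2,-3],![2,-1,0,0,2,0,0],![1,-2,1,-1,0,0,-1]],
    ![![0,1,0,0,0,0,0],![0,0,0,0,1,0,0],![0,0,0,0,0,1,0],![13,-1,0,0,0,2,0],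
      ![69,-1,-2,-3,-3,-2,-2],![-61,-2,1,2,-2,-3,2],![-67,-2,-3,-2,2,-2,-3]],
    ![![0,0,1,0,0,0,0],![0,0,0,0,0,1,0],![0,0,0,0,0,0,1],![19,2,0,2,-2,-3,0],
      ![-23,-3,-3,-3,-2,-1,2],![29,1,-2,-1,0,0,-3],![28,-1,1,0,-2,2,2]],
    ![![0,0,0,1,0,0,0],![13,-1,0,0,0,2,0],![19,2,0,2,-2,-3,0],![10,2,-3,0,0,-3,-1],
      ![55,-2,-2,-3,-1,0,-1],![-61,2,-3,-3,-1,-2,-2],![-60,-3,-1,-1,1,-2,-1]],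
    ![![1,-2,1,-2,-3,2,-3],![69,-1,-2,-3,-3,-2,-2],![-23,-3,-3,-3,-2,-1,2],
      ![55,-2,-2,-3,-1,0,-1],![342,-2,-1,0,1,-3,-2],![-412,0,-2,0,0,0,-3],
      ![-209,1,-2,-1,-2,-1,-2]],
    ![![2,-1,0,0,2,0,0],![-61,-2,1,2,-2,-3,2],![29,1,-2,-1,0,0,-3],![-61,2,-3,-3,-1,-2,-2],
      ![-412,0,-2,0,0,0,-3],![469,-2,-1,-3,0,0,2],![270,-3,-3,-1,-2,-1,-1]],
    ![![1,-2,1,-1,0,0,-1],![-67,-2,-3,-2,2,-2,-3],![28,-1,1,0,-2,2,2],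
      ![-60,-3,-1,-1,1,-2,-1],![-209,1,-2,-1,-2,-1,-2],![270,-3,-3,-1,-2,-1,-1],
      ![126,-3,-2,1,0,-3,2]]]

/-- The first index of the pair of variables whose product is the basis monomial number `s`. -/
def wFst : Fin 7 → Fin 7 := ![0, 0, 0, 0, 1, 1, 2]

/-- The second index of the pair of variables whose product is the basis monomial number `s`. -/
def wSnd : Fin 7 → Fin 7 := ![0, 1, 2, 3, 1, 2, 2]

theorem quad_comm : ∀ i j s, quad i j s = quad j i s := by decide +kernel

theorem quad_wFst_wSnd : ∀ s t, quad (wFst s) (wSnd s) t = if s = t then 1 else 0 := by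
  decide +kernel

namespace SpanningCheck

/-- Bit `s` of `quadMask i j` is the parity of `quad i j s`. -/
def quadMask (i j : ℕ) : ℕ :=
  ([[1, 2, 4, 8, 85, 2, 77], [2, 16, 32, 3, 27, 37, 69], [4, 32, 64, 33, 47, 75, 6],
    [8, 3, 33, 100, 89, 29, 94], [85, 27, 47, 89, 52, 64, 43], [2, 37, 75, 29, 64, 13, 110],
    [77, 69, 6, 94, 43, 110, 42]].getD i []).getD j 0

theorem quad_emod_two :
    ∀ i j s : Fin 7, quad i j s % 2 = ((quadMask i j >>> (s : ℕ) % 2 : ℕ) : ℤ) := by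
  decide +kernel

/-- The bitwise exclusive or of `f 0, …, f (n - 1)`. -/
def xorSum (f : ℕ → ℕ) : ℕ → ℕ
  | 0 => 0
  | n + 1 => xorSum f n ^^^ f n

theorem bitEval_xorSum (u : ℕ → ZMod 2) (n : ℕ) (f : ℕ → ℕ) (m : ℕ) :
    bitEval u n (xorSum f m) = ∑ t ∈ Finset.range m, bitEval u n (f t) := by
  induction m with
  | zero => simp [xorSum, bitEval_zero]
  | succ m ih => rw [xorSum, bitEval_xor, ih, Finset.sum_range_succ]

/-- One side of the associativity relation, as a linear form in the variables number
`49 * l + 7 * s + σ` and `343 + (49 * i + 7 * j + k)`. -/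
def assocRow (l i j σ : ℕ) : ℕ :=
  xorSum (fun t => ((quadMask i j >>> t) % 2) <<< (49 * l + 7 * t + σ) ^^^
    ((quadMask l t >>> σ) % 2) <<< (343 + (49 * i + 7 * j + t))) 7

/-- The linear system expressing associativity, commutativity and the normalizations. -/
def rows : List ℕ :=
  ((List.range 7).flatMap fun j => (List.range j).flatMap fun l => (List.range 7).flatMap fun i =>
    (List.range 7).map fun σ => assocRow l i j σ ^^^ assocRow j l i σ) ++
  ((List.range 7).flatMap fun i => (List.range i).flatMap fun j => (List.range 7).map fun k =>
    1 <<< (343 + (49 * i + 7 * j + k)) ^^^ 1 <<< (343 + (49 * j + 7 * i + k))) ++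
  ([(0, 0), (0, 1), (0, 2), (0, 3), (1, 1), (1, 2), (2, 2)].flatMap fun p : ℕ × ℕ =>
    (List.range 7).map fun k => 1 <<< (343 + (49 * p.1 + 7 * p.2 + k))) ++
  ((List.range 6).map fun i => 1 <<< (343 + (49 * i + 7 * 6 + 6))) ++
  [1 <<< (343 + (49 * 5 + 7 * 6 + 5))]

theorem elimCheck_rows :
    force (fun L => force (fun M => elimCheck 686 L 686 M) (pack 686 rows))
      (pack 686 (rows.map fun _ => 1)) = true := by
  decide +kernel

theorem rows_lt : ∀ r ∈ rows, r < 2 ^ 686 := by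
  have : (rows.all fun r => Nat.ble (r + 1) (2 ^ 686)) = true := by decide +kernel
  intro r hr
  exact Nat.le_of_ble_eq_true (List.all_eq_true.1 this r hr)

theorem eq_zero_of_rows (Z Y : ℕ → ℕ → ℕ → ZMod 2)
    (hassoc : ∀ l < 7, ∀ i < 7, ∀ j < 7, ∀ σ < 7,
      ∑ t ∈ Finset.range 7, (((quadMask i j >>> t : ℕ) : ZMod 2) * Z l t σ
        + ((quadMask l t >>> σ : ℕ) : ZMod 2) * Y i j t)
      = ∑ t ∈ Finset.range 7, (((quadMask l i >>> t : ℕ) : ZMod 2) * Z j t σ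
        + ((quadMask j t >>> σ : ℕ) : ZMod 2) * Y l i t))
    (hcomm : ∀ i < 7, ∀ j < 7, ∀ k < 7, Y i j k = Y j i k)
    (hw : ∀ p ∈ [(0, 0), (0, 1), (0, 2), (0, 3), (1, 1), (1, 2), (2, 2)], ∀ k < 7,
      Y (Prod.fst p) (Prod.snd p) k = 0)
    (h66 : ∀ i < 6, Y i 6 6 = 0) (h565 : Y 5 6 5 = 0) :
    ∀ i < 7, ∀ j < 7, ∀ k < 7, Z i j k = 0 ∧ Y i j k = 0 := by
  set u : ℕ → ZMod 2 := fun c => if c < 343 then Z (c / 49) (c / 7 % 7) (c % 7) else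
    Y ((c - 343) / 49) ((c - 343) / 7 % 7) ((c - 343) % 7) with hu
  have hZ : ∀ i < 7, ∀ j < 7, ∀ k < 7, u (49 * i + 7 * j + k) = Z i j k := by
    intro i hi j hj k hk
    simp only [hu]
    rw [if_pos (by omega), show (49 * i + 7 * j + k) / 49 = i by omega,
      show (49 * i + 7 * j + k) / 7 % 7 = j by omega, show (49 * i + 7 * j + k) % 7 = k by omega]
  have hY : ∀ i < 7, ∀ j < 7, ∀ k < 7, u (343 + (49 * i + 7 * j + k)) = Y i j k := by
    intro i hi j hj k hk
    simp only [hu]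
    rw [if_neg (by omega), Nat.add_sub_cancel_left, show (49 * i + 7 * j + k) / 49 = i by omega,
      show (49 * i + 7 * j + k) / 7 % 7 = j by omega, show (49 * i + 7 * j + k) % 7 = k by omega]
  have hrow : ∀ l < 7, ∀ i < 7, ∀ j < 7, ∀ σ < 7, bitEval u 686 (assocRow l i j σ)
      = ∑ t ∈ Finset.range 7, (((quadMask i j >>> t : ℕ) : ZMod 2) * Z l t σ
        + ((quadMask l t >>> σ : ℕ) : ZMod 2) * Y i j t) := by
    intro l hl i hi j hj σ hσ
    rw [assocRow, bitEval_xorSum]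
    refine Finset.sum_congr rfl fun t ht => ?_
    have ht := Finset.mem_range.1 ht
    rw [bitEval_xor, bitEval_bit_shiftLeft _ _ (by omega), bitEval_bit_shiftLeft _ _ (by omega),
      hZ l hl t ht σ hσ, hY i hi j hj t ht]
  have hone : ∀ i < 7, ∀ j < 7, ∀ k < 7,
      bitEval u 686 (1 <<< (343 + (49 * i + 7 * j + k))) = Y i j k := by
    intro i hi j hj k hk
    rw [bitEval_one_shiftLeft u (by omega), hY i hi j hj k hk]
  have hzero : ∀ r ∈ rows, bitEval u 686 r = 0 := by
    intro r hr
    simp only [rows, List.mem_append, List.mem_flatMap, List.mem_map, List.mem_range] at hr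
    rcases hr with (((⟨j, hj, l, hl, i, hi, σ, hσ, rfl⟩ | ⟨i, hi, j, hj, k, hk, rfl⟩) |
      ⟨p, hp, k, hk, rfl⟩) | ⟨i, hi, rfl⟩) | hr
    · rw [bitEval_xor, hrow l (by omega) i hi j hj σ hσ, hrow j hj l (by omega) i hi σ hσ,
        hassoc l (by omega) i hi j hj σ hσ, CharTwo.add_self_eq_zero]
    · rw [bitEval_xor, hone i hi j (by omega) k hk, hone j (by omega) i hi k hk,
        hcomm i hi j (by omega) k hk, CharTwo.add_self_eq_zero]
    · have hlt : ∀ p ∈ [(0, 0), (0, 1), (0, 2), (0, 3), (1, 1), (1, 2), (2, 2)],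
          Prod.fst p < 7 ∧ Prod.snd p < 7 := by decide
      rw [hone _ (hlt p hp).1 _ (hlt p hp).2 k hk, hw p hp k hk]
    · rw [hone i (by omega) 6 (by omega) 6 (by omega), h66 i hi]
    · rw [List.mem_singleton.1 hr, hone 5 (by omega) 6 (by omega) 5 (by omega), h565]
  have hcheck := elimCheck_rows
  rw [force_eq, force_eq] at hcheck
  have := eq_zero_of_elimCheck (by omega) 686 u rows rows_lt hzero hcheck
  intro i hi j hj k hk
  exact ⟨hZ i hi j hj k hk ▸ this _ (by omega), hY i hi j hj k hk ▸ this _ (by omega)⟩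

end SpanningCheck

theorem quad_cast_zmod_two (i j s : Fin 7) :
    ((quad i j s : ℤ) : ZMod 2) = ((SpanningCheck.quadMask i j >>> (s : ℕ) : ℕ) : ZMod 2) := by
  rw [← Int.cast_natCast, ZMod.intCast_eq_intCast_iff]
  have h := SpanningCheck.quad_emod_two i j s
  rw [Int.ModEq]
  push_cast at h ⊢
  omega

theorem eq_zero_of_assoc_zmod_two (Z Y : Fin 7 → Fin 7 → Fin 7 → ZMod 2)
    (hassoc : ∀ l i j σ, ∑ t, (quad i j t • Z l t σ + quad l t σ • Y i j t)
      = ∑ t, (quad l i t • Z j t σ + quad j t σ • Y l i t))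
    (hcomm : ∀ i j k, Y i j k = Y j i k) (hw : ∀ s k, Y (wFst s) (wSnd s) k = 0)
    (h66 : ∀ i, i ≠ 6 → Y i 6 6 = 0) (h565 : Y 5 6 5 = 0) (i j k : Fin 7) :
    Z i j k = 0 ∧ Y i j k = 0 := by
  have hof : ∀ i : Fin 7, Fin.ofNat 7 (i : ℕ) = i := fun i => by simp
  have := SpanningCheck.eq_zero_of_rows
    (fun i j k => Z (Fin.ofNat 7 i) (Fin.ofNat 7 j) (Fin.ofNat 7 k))
    (fun i j k => Y (Fin.ofNat 7 i) (Fin.ofNat 7 j) (Fin.ofNat 7 k)) ?_ ?_ ?_ ?_ ?_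
    i i.2 j j.2 k k.2
  · simpa only [hof] using this
  · intro l hl i hi j hj σ hσ
    lift l to Fin 7 using hl
    lift i to Fin 7 using hi
    lift j to Fin 7 using hj
    lift σ to Fin 7 using hσ
    have := hassoc l i j σ
    simp only [zsmul_eq_mul, quad_cast_zmod_two] at this
    rw [Finset.sum_range, Finset.sum_range]
    simpa only [hof] using this
  · exact fun i _ j _ k _ => hcomm _ _ _
  · intro p hp k _
    simp only [List.mem_cons, List.not_mem_nil, or_false] at hp
    rcases hp with rfl | rfl | rfl | rfl | rfl | rfl | rfl
    exacts [hw 0 _, hw 1 _, hw 2 _, hw 3 _, hw 4 _, hw 5 _, hw 6 _]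
  · intro i hi
    refine h66 _ fun h => ?_
    have := congrArg Fin.val h
    simp at this
    omega
  · exact h565

/-- A finite family in a torsion-free abelian group vanishes if it does so modulo `2` under every
homomorphism defined on the subgroup it generates. -/
theorem eq_zero_of_forall_zmod_two {V ι : Type*} [AddCommGroup V] [Module.IsTorsionFree ℤ V]
    [Finite ι] (v : ι → V)
    (h : ∀ φ : Submodule.span ℤ (Set.range v) →+ ZMod 2, ∀ i,
      φ ⟨v i, Submodule.subset_span ⟨i, rfl⟩⟩ = 0) (i : ι) : v i = 0 := by
  set M := Submodule.span ℤ (Set.range v)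
  have : Module.Finite ℤ M := Module.Finite.span_of_finite ℤ (Set.finite_range v)
  have : Module.Free ℤ M := Module.free_of_finite_type_torsion_free'
  let b := Module.Free.chooseBasis ℤ M
  have hempty : IsEmpty (Module.Free.ChooseBasisIndex ℤ M) := by
    refine ⟨fun k => ?_⟩
    let φ : M →+ ZMod 2 := (Int.castAddHom (ZMod 2)).comp (b.coord k).toAddMonoidHom
    have hφ : ∀ x, φ.toIntLinearMap x = 0 := by
      rintro ⟨x, hx⟩
      induction hx using Submodule.span_induction with
      | mem x hx => obtain ⟨i, rfl⟩ := hx; exact h φ i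
      | zero => exact map_zero φ.toIntLinearMap
      | add x y hx hy ihx ihy =>
        exact (map_add φ.toIntLinearMap ⟨x, hx⟩ ⟨y, hy⟩).trans (by rw [ihx, ihy, add_zero])
      | smul n x hx ih =>
        exact (map_smul φ.toIntLinearMap n ⟨x, hx⟩).trans (by rw [ih, smul_zero])
    have := hφ (b k)
    simp [φ] at this
  have : Subsingleton M := b.repr.toEquiv.subsingleton
  exact congrArg Subtype.val
    (Subsingleton.elim (⟨v i, Submodule.subset_span ⟨i, rfl⟩⟩ : M) 0)

/-- The infinitesimal rigidity of the local component, in coordinates. -/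
theorem eq_zero_of_assoc {K : Type*} [Field K] [CharZero K] (Z Y : Fin 7 → Fin 7 → Fin 7 → K)
    (hassoc : ∀ l i j σ, ∑ t, (quad i j t • Z l t σ + quad l t σ • Y i j t)
      = ∑ t, (quad l i t • Z j t σ + quad j t σ • Y l i t))
    (hcomm : ∀ i j k, Y i j k = Y j i k) (hw : ∀ s k, Y (wFst s) (wSnd s) k = 0)
    (h66 : ∀ i, i ≠ 6 → Y i 6 6 = 0) (h565 : Y 5 6 5 = 0) (i j k : Fin 7) :
    Z i j k = 0 ∧ Y i j k = 0 := by
  let v : Bool × Fin 7 × Fin 7 × Fin 7 → K := fun c =>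
    bif c.1 then Z c.2.1 c.2.2.1 c.2.2.2 else Y c.2.1 c.2.2.1 c.2.2.2
  suffices h : ∀ c, v c = 0 from ⟨h (true, i, j, k), h (false, i, j, k)⟩
  refine eq_zero_of_forall_zmod_two v fun φ => ?_
  let v' : Bool × Fin 7 × Fin 7 × Fin 7 → Submodule.span ℤ (Set.range v) := fun c =>
    ⟨v c, Submodule.subset_span ⟨c, rfl⟩⟩
  have key := eq_zero_of_assoc_zmod_two (fun i j k => φ (v' (true, i, j, k)))
    (fun i j k => φ (v' (false, i, j, k))) (fun l i j σ => ?_)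
    (fun i j k => congrArg φ (Subtype.ext (hcomm i j k)))
    (fun s k => (congrArg φ (Subtype.ext (hw s k))).trans φ.map_zero)
    (fun i hi => (congrArg φ (Subtype.ext (h66 i hi))).trans φ.map_zero)
    ((congrArg φ (Subtype.ext h565)).trans φ.map_zero)
  · rintro ⟨_ | _, i, j, k⟩
    exacts [(key i j k).2, (key i j k).1]
  · simp only [← map_zsmul, ← map_add, ← map_sum]
    refine congrArg φ (Subtype.ext ?_)
    simpa [v', v] using hassoc l i j σ

/-- Coordinates on the local component `e A` of a `K`-algebra `A`, relative to the basis formed by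
`e`, the `x i` and the products `x (wFst s) * x (wSnd s)`. -/
structure LocalCoords (K A : Type*) [Field K] [CommRing A] [Algebra K A] (e : A)
    (x : Fin 7 → A) where
  ε : A →ₗ[K] K
  ξ : Fin 7 → A →ₗ[K] K
  ω : Fin 7 → A →ₗ[K] K
  e_mul_x : ∀ i, e * x i = x i
  x_mul_x : ∀ i j, x i * x j = ∑ s, quad i j s • (x (wFst s) * x (wSnd s))
  x_mul_w : ∀ i s, x i * (x (wFst s) * x (wSnd s)) = 0
  ε_e : ε e = 1
  ξ_e : ∀ k, ξ k e = 0
  ε_x_mul : ∀ l a, ε (x l * a) = 0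
  ξ_x_mul : ∀ k l a, ξ k (x l * a) = if k = l then ε a else 0
  ω_x_mul : ∀ s l a, ω s (x l * a) = ∑ k, quad l k s • ξ k a
  eq_sum : ∀ a, e * a = a →
    a = ε a • e + ∑ k, ξ k a • x k + ∑ s, ω s a • (x (wFst s) * x (wSnd s))

namespace LocalCoords

variable {K A : Type*} [Field K] [CommRing A] [Algebra K A] {e : A} {x : Fin 7 → A}
  (F : LocalCoords K A e x)

include F

theorem x_mul_e (i : Fin 7) : x i * e = x i := by rw [mul_comm, F.e_mul_x]

theorem ξ_x (k l : Fin 7) : F.ξ k (x l) = if k = l then 1 else 0 := by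
  rw [← F.x_mul_e, F.ξ_x_mul, F.ε_e]

theorem ω_x (s l : Fin 7) : F.ω s (x l) = 0 := by
  rw [← F.x_mul_e, F.ω_x_mul]
  simp [F.ξ_e]

/-- The variation of the product `x i * x j - ∑ s, quad i j s • (x (wFst s) * x (wSnd s))` under
the infinitesimal translation by `a`. -/
def transl (x : Fin 7 → A) (a : Fin 7 → K) (i j : Fin 7) : A :=
  a i • x j + a j • x i
    - ∑ s, quad i j s • (a (wFst s) • x (wSnd s) + a (wSnd s) • x (wFst s))

/-- The variation of the product `x l * (x (wFst s) * x (wSnd s))` under the infinitesimal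
translation by `a`. -/
def translW (x : Fin 7 → A) (a : Fin 7 → K) (l s : Fin 7) : A :=
  a l • (x (wFst s) * x (wSnd s)) + a (wFst s) • (x l * x (wSnd s))
    + a (wSnd s) • (x l * x (wFst s))

theorem sum_translW_add (a : Fin 7 → K) (l i j : Fin 7) :
    ∑ s, quad i j s • translW x a l s + x l * transl x a i j
      = a l • (x i * x j) + a i • (x l * x j) + a j • (x l * x i) := by
  rw [transl, F.x_mul_x i j, mul_sub, Finset.mul_sum, add_sub_assoc', sub_eq_iff_eq_add,
    Finset.smul_sum]
  simp only [translW, smul_add, mul_add, Finset.sum_add_distrib, mul_smul_comm,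
    smul_comm (a l)]
  abel

theorem assoc_eq_zero [CharZero K] {y z : Fin 7 → Fin 7 → A}
    (hy : ∀ i j, e * y i j = y i j) (hz : ∀ l s, e * z l s = z l s)
    (hcomm : ∀ i j, y i j = y j i) (hw : ∀ s, y (wFst s) (wSnd s) = 0)
    (hassoc : ∀ l i j, ∑ s, quad i j s • z l s + x l * y i j
      = ∑ s, quad l i s • z j s + x j * y l i)
    (h66 : ∀ i, i ≠ 6 → F.ξ 6 (y i 6) = 0) (h565 : F.ξ 5 (y 5 6) = 0) :
    (∀ i j, y i j = ∑ s, F.ω s (y i j) • (x (wFst s) * x (wSnd s))) ∧ ∀ l s, z l s = 0 := by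
  have hεz : ∀ l s, F.ε (z l s) = 0 := by
    intro l s
    refine (eq_zero_of_assoc (fun l s _ => F.ε (z l s)) (fun _ _ _ => 0) (fun l i j σ => ?_)
      (by simp) (by simp) (by simp) rfl l s 0).1
    have := congrArg F.ε (hassoc l i j)
    simpa [-zsmul_eq_mul, map_zsmul, F.ε_x_mul] using this
  have hεy : ∀ i j, F.ε (y i j) = 0 := by
    intro i j
    have := (eq_zero_of_assoc (fun l s σ => F.ω σ (x 0 * z l s))
      (fun i j k => if k = 0 then F.ε (y i j) else 0) (fun l i j σ => ?_)
      (fun i j k => by rw [hcomm]) (by simp [hw]) (fun _ _ => rfl) rfl i j 0).2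
    · simpa using this
    · have := congrArg (fun a => F.ω σ (x 0 * a)) (hassoc l i j)
      simp only [mul_add, Finset.mul_sum, mul_smul_comm, map_add, map_sum, map_zsmul] at this
      rw [F.ω_x_mul σ 0 (x l * _), F.ω_x_mul σ 0 (x j * _)] at this
      simp only [F.ξ_x_mul, smul_ite, smul_zero, Finset.sum_ite_eq', Finset.mem_univ,
        if_true] at this
      simpa [Finset.sum_add_distrib, quad_comm _ 0] using this
  have hξz : ∀ p l s, F.ξ p (z l s) = 0 := by
    intro p l s
    refine (eq_zero_of_assoc (fun l s _ => F.ξ p (z l s)) (fun _ _ _ => 0) (fun l i j σ => ?_)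
      (by simp) (by simp) (by simp) rfl l s 0).1
    have := congrArg (F.ξ p) (hassoc l i j)
    simpa [-zsmul_eq_mul, map_zsmul, F.ξ_x_mul, hεy] using this
  have key := eq_zero_of_assoc (fun l s σ => F.ω σ (z l s)) (fun i j k => F.ξ k (y i j))
    (fun l i j σ => by
      have := congrArg (F.ω σ) (hassoc l i j)
      simpa [-zsmul_eq_mul, map_zsmul, F.ω_x_mul, Finset.sum_add_distrib] using this)
    (fun i j k => by rw [hcomm]) (fun s k => by rw [hw, map_zero]) h66 h565
  refine ⟨fun i j => ?_, fun l s => ?_⟩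
  · conv_lhs => rw [F.eq_sum _ (hy i j)]
    simp [hεy, (key i j _).2]
  · rw [F.eq_sum _ (hz l s)]
    simp [hεz, hξz, (key l s _).1]

/-- First-order deformations of the local component are translations. -/
theorem exists_eq_transl [CharZero K] {y z : Fin 7 → Fin 7 → A}
    (hy : ∀ i j, e * y i j = y i j) (hz : ∀ l s, e * z l s = z l s)
    (hcomm : ∀ i j, y i j = y j i) (hw : ∀ s, y (wFst s) (wSnd s) = 0)
    (hassoc : ∀ l i j, ∑ s, quad i j s • z l s + x l * y i j
      = ∑ s, quad l i s • z j s + x j * y l i) :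
    ∃ (a : Fin 7 → K) (b : Fin 7 → Fin 7 → Fin 7 → K),
      (∀ i j s, b i j s = b j i s) ∧ (∀ s t, b (wFst s) (wSnd s) t = 0) ∧
      (∀ i j, y i j = ∑ s, b i j s • (x (wFst s) * x (wSnd s)) + transl x a i j) ∧
      ∀ l s, z l s = translW x a l s := by
  let a : Fin 7 → K := fun i => if i = 6 then F.ξ 5 (y 5 6) else F.ξ 6 (y i 6)
  have hxe : ∀ i j, e * (x i * x j) = x i * x j := fun i j => by rw [← mul_assoc, F.e_mul_x]
  have hwF : ∀ s, 5 ≠ wFst s ∧ 6 ≠ wFst s ∧ 5 ≠ wSnd s ∧ 6 ≠ wSnd s := by decide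
  have htr : ∀ i j, F.ξ 6 (transl x a i j) = a i * F.ξ 6 (x j) + a j * F.ξ 6 (x i) ∧
      F.ξ 5 (transl x a i j) = a i * F.ξ 5 (x j) + a j * F.ξ 5 (x i) := fun i j => by
    simp [transl, F.ξ_x, hwF, map_zsmul, -zsmul_eq_mul]
  have htrw : ∀ s, transl x a (wFst s) (wSnd s) = 0 := fun s => by
    simp [transl, quad_wFst_wSnd, ite_smul, -zsmul_eq_mul, -smul_add]
  have key := F.assoc_eq_zero (y := fun i j => y i j - transl x a i j)
    (z := fun l s => z l s - translW x a l s) ?_ ?_ ?_ ?_ ?_ ?_ ?_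
  · refine ⟨a, fun i j s => F.ω s (y i j), fun i j s => by simp only [hcomm i j],
      fun s t => by simp only [hw, map_zero], fun i j => ?_, fun l s => sub_eq_zero.1 (key.2 l s)⟩
    have := key.1 i j
    have hω : ∀ s, F.ω s (transl x a i j) = 0 := fun s => by
      simp [transl, F.ω_x, map_zsmul, -zsmul_eq_mul]
    simp only [map_sub, hω, sub_zero] at this
    rw [← this, sub_add_cancel]
  · intro i j
    simp only [transl, mul_sub, mul_add, hy, mul_smul_comm, Finset.mul_sum, F.e_mul_x]
  · intro l s
    simp only [translW, mul_sub, mul_add, hz, mul_smul_comm, hxe]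
  · intro i j
    simp only [transl, hcomm i j, quad_comm i j, add_comm (a i • _)]
  · intro s
    rw [hw, htrw, sub_zero]
  · intro l i j
    simp only [smul_sub, mul_sub, Finset.sum_sub_distrib]
    rw [sub_add_sub_comm, sub_add_sub_comm, hassoc, F.sum_translW_add, F.sum_translW_add,
      mul_comm (x l) (x i), mul_comm (x j) (x l), mul_comm (x i) (x j)]
    abel
  · intro i hi
    rw [map_sub, (htr i 6).1]
    simp [F.ξ_x, hi.symm, a, hi]
  · rw [map_sub, (htr 5 6).2]
    simp [F.ξ_x, a]

end LocalCoords

/-- The elements `e` and `x i` satisfy the relations of the local component of `R ⧸ 𝔞`. -/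
structure IsLocalModel {A : Type*} [CommRing A] (e : A) (x : Fin 7 → A) : Prop where
  e_mul_e : e * e = e
  e_mul_x : ∀ i, e * x i = x i
  x_mul_x : ∀ i j, x i * x j = ∑ s, quad i j s • (x (wFst s) * x (wSnd s))
  x_mul_w : ∀ i s, x i * (x (wFst s) * x (wSnd s)) = 0

/-- The products `x l * (x i * x j)` vanish as soon as those in the first three variables and
`x 0 * (x 0 * x 3)` do. -/
theorem x_mul_w_eq_zero {A : Type*} [CommRing A] {x : Fin 7 → A}
    (hq : ∀ i j, x i * x j = ∑ s, quad i j s • (x (wFst s) * x (wSnd s)))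
    (h000 : x 0 * x 0 * x 0 = 0) (h001 : x 0 * x 0 * x 1 = 0) (h002 : x 0 * x 0 * x 2 = 0)
    (h003 : x 0 * x 0 * x 3 = 0) (h011 : x 0 * x 1 * x 1 = 0) (h012 : x 0 * x 1 * x 2 = 0)
    (h022 : x 0 * x 2 * x 2 = 0) (h111 : x 1 * x 1 * x 1 = 0) (h112 : x 1 * x 1 * x 2 = 0)
    (h122 : x 1 * x 2 * x 2 = 0) (h222 : x 2 * x 2 * x 2 = 0) (l s : Fin 7) :
    x l * (x (wFst s) * x (wSnd s)) = 0 := by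
  have h13 := hq 1 3
  have h23 := hq 2 3
  have h33 := hq 3 3
  simp only [Fin.sum_univ_seven, quad, wFst, wSnd, Matrix.cons_val, zsmul_eq_mul] at h13 h23 h33
  push_cast at h13 h23 h33
  have h013 : x 0 * x 1 * x 3 = 0 := by
    linear_combination x 0 * h13 + 13 * h000 - h001 + 2 * h012
  have h023 : x 0 * x 2 * x 3 = 0 := by
    linear_combination x 0 * h23 + 19 * h000 + 2 * h001 + 2 * h003 - 2 * h011 - 3 * h012
  have h033 : x 0 * x 3 * x 3 = 0 := by
    linear_combination x 0 * h33 + 10 * h000 + 2 * h001 - 3 * h002 - 3 * h012 - h022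
  have h113 : x 1 * x 1 * x 3 = 0 := by
    linear_combination x 1 * h13 + 13 * h001 - h011 + 2 * h112
  have h123 : x 1 * x 2 * x 3 = 0 := by
    linear_combination x 2 * h13 + 13 * h002 - h012 + 2 * h122
  have h223 : x 2 * x 2 * x 3 = 0 := by
    linear_combination x 2 * h23 + 19 * h002 + 2 * h012 + 2 * h023 - 2 * h112 - 3 * h122
  have hsmall : ∀ l : Fin 7, l ≤ 3 → ∀ s, x l * (x (wFst s) * x (wSnd s)) = 0 := by
    intro l hl s
    have hl' : l = 0 ∨ l = 1 ∨ l = 2 ∨ l = 3 := by revert l; decide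
    rcases hl' with rfl | rfl | rfl | rfl <;> fin_cases s <;>
      simp only [wFst, wSnd, Fin.zero_eta, Fin.mk_one, Fin.reduceFinMk, Matrix.cons_val] <;>
      grind
  have hle : ∀ s, wSnd s ≤ 3 := by decide
  rw [← mul_assoc, hq, Finset.sum_mul]
  refine Finset.sum_eq_zero fun t _ => ?_
  rw [smul_mul_assoc, mul_comm, hsmall _ (hle s), smul_zero]

/-- The relations of `R ⧸ 𝔞` exhibit a local component, cut out by the idempotent `1 + x 0 ^ 3`,
and a point at which the coordinates are constants. -/
theorem isLocalModel_of_aGens {K A : Type} [Field K] [CommRing A] [Algebra K A] (x : Fin 7 → A)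
    (h : ∀ p ∈ aGens K, aeval x p = 0) :
    IsLocalModel (1 + x 0 ^ 3) (fun i => (1 + x 0 ^ 3) * x i) ∧
      ∀ i, ∃ c : K, x i * (1 - (1 + x 0 ^ 3)) = c • (1 - (1 + x 0 ^ 3)) := by
  simp only [aGens, Set.forall_mem_insert, Set.mem_singleton_iff, forall_eq, map_sub, map_add,
    map_neg, map_mul, map_pow, aeval_X, map_ofNat] at h
  obtain ⟨h66, h56, h46, h36, h26, h16, h06, h55, h45, h35, h25, h15, h05, h44, h34, h24, h14,
    h04, h33, h23, h13, h003, h222, h122, h022, h112, h012, h002, h111, h011, h001, h0000⟩ := h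
  have h : (1 + x 0 ^ 3) * x 0 ^ 3 = 0 := by
    linear_combination (x 0 ^ 2 - x 0 + 1) * h0000
  have he : (1 + x 0 ^ 3) * (1 + x 0 ^ 3) = 1 + x 0 ^ 3 := by linear_combination h
  have ha : ∀ (c : ℤ) (i : Fin 7), x i * x 0 ^ 3 = c * x 0 ^ 3 →
      ∃ c : K, x i * (1 - (1 + x 0 ^ 3)) = c • (1 - (1 + x 0 ^ 3)) := fun c i hc =>
    ⟨c, by rw [Int.cast_smul_eq_zsmul, zsmul_eq_mul]; linear_combination -hc⟩
  have a0 : x 0 * x 0 ^ 3 = -1 * x 0 ^ 3 := by linear_combination h0000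
  have a1 : x 1 * x 0 ^ 3 = 3 * x 0 ^ 3 := by linear_combination x 0 * h001 - 3 * h0000
  have a2 : x 2 * x 0 ^ 3 = -1 * x 0 ^ 3 := by linear_combination x 0 * h002 + h0000
  have a3 : x 3 * x 0 ^ 3 = 3 * x 0 ^ 3 := by linear_combination x 0 * h003 - 3 * h0000
  have a4 : x 4 * x 0 ^ 3 = 19 * x 0 ^ 3 := by
    linear_combination -x 0 ^ 3 * h04
      + (x 4 + 3 * x 0 ^ 2 - 4 * x 0 + 2 * x 1 - x 2 + 2 * x 3 + 4) * a0
      + (3 * x 1 - 2 * x 2 + 7) * a1 + (3 * x 2 - 8) * a2 - 2 * a3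
  have a5 : x 5 * x 0 ^ 3 = -22 * x 0 ^ 3 := by
    linear_combination -x 0 ^ 3 * h05 + (x 5 - x 0 ^ 2 - x 0 + x 1 + 1) * a0
      - (2 * x 1 + 7) * a1
  have a6 : x 6 * x 0 ^ 3 = -12 * x 0 ^ 3 := by
    linear_combination -x 0 ^ 3 * h06
      + (x 6 + 2 * x 0 ^ 2 - 3 * x 0 + 2 * x 1 - x 2 + x 3 + 3) * a0 - 2 * a1 + x 2 * a2 - a3
  have hmul : ∀ i j, (1 + x 0 ^ 3) * x i * ((1 + x 0 ^ 3) * x j) = (1 + x 0 ^ 3) * (x i * x j) :=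
    fun i j => by linear_combination (x i * x j) * he
  have hmul3 : ∀ i j k, (1 + x 0 ^ 3) * x i * ((1 + x 0 ^ 3) * x j) * ((1 + x 0 ^ 3) * x k)
      = (1 + x 0 ^ 3) * (x i * x j * x k) :=
    fun i j k => by rw [hmul]; linear_combination (x i * x j * x k) * he
  let D : Fin 7 → Fin 7 → A := fun i j =>
    ∑ s, quad i j s • ((1 + x 0 ^ 3) * (x (wFst s) * x (wSnd s)))
  let P : Fin 7 → Fin 7 → Prop := fun i j => (1 + x 0 ^ 3) * (x i * x j) = D i j
  have hcomm : ∀ {i j}, P i j → P j i := fun {i j} hij => by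
    simp only [P, D, mul_comm (x j), quad_comm j] at hij ⊢
    exact hij
  have hw : ∀ s, P (wFst s) (wSnd s) := fun s => by
    simp [P, D, quad_wFst_wSnd, ite_smul, -zsmul_eq_mul]
  have hD : ∀ i j, D i j = quad i j 0 * ((1 + x 0 ^ 3) * (x 0 * x 0))
      + quad i j 1 * ((1 + x 0 ^ 3) * (x 0 * x 1)) + quad i j 2 * ((1 + x 0 ^ 3) * (x 0 * x 2))
      + quad i j 3 * ((1 + x 0 ^ 3) * (x 0 * x 3)) + quad i j 4 * ((1 + x 0 ^ 3) * (x 1 * x 1))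
      + quad i j 5 * ((1 + x 0 ^ 3) * (x 1 * x 2)) + quad i j 6 * ((1 + x 0 ^ 3) * (x 2 * x 2)) :=
    fun i j => by simp only [D, Fin.sum_univ_seven, zsmul_eq_mul]; rfl
  have q04 : P 0 4 := by
    simp only [P, hD, quad, Matrix.cons_val]; push_cast
    linear_combination (1 + x 0 ^ 3) * h04 - 3 * h
  have q05 : P 0 5 := by
    simp only [P, hD, quad, Matrix.cons_val]; push_cast
    linear_combination (1 + x 0 ^ 3) * h05 + h
  have q06 : P 0 6 := by
    simp only [P, hD, quad, Matrix.cons_val]; push_cast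
    linear_combination (1 + x 0 ^ 3) * h06 - 2 * h
  have q13 : P 1 3 := by
    simp only [P, hD, quad, Matrix.cons_val]; push_cast
    linear_combination (1 + x 0 ^ 3) * h13 + h
  have q14 : P 1 4 := by
    simp only [P, hD, quad, Matrix.cons_val]; push_cast
    linear_combination (1 + x 0 ^ 3) * h14 - h
  have q15 : P 1 5 := by
    simp only [P, hD, quad, Matrix.cons_val]; push_cast
    linear_combination (1 + x 0 ^ 3) * h15 - h
  have q16 : P 1 6 := by
    simp only [P, hD, quad, Matrix.cons_val]; push_cast
    linear_combination (1 + x 0 ^ 3) * h16 - h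
  have q23 : P 2 3 := by
    simp only [P, hD, quad, Matrix.cons_val]; push_cast
    linear_combination (1 + x 0 ^ 3) * h23 + h
  have q24 : P 2 4 := by
    simp only [P, hD, quad, Matrix.cons_val]; push_cast
    linear_combination (1 + x 0 ^ 3) * h24 - 2 * h
  have q25 : P 2 5 := by
    simp only [P, hD, quad, Matrix.cons_val]; push_cast
    linear_combination (1 + x 0 ^ 3) * h25 + 2 * h
  have q26 : P 2 6 := by
    simp only [P, hD, quad, Matrix.cons_val]; push_cast
    linear_combination (1 + x 0 ^ 3) * h26 - 2 * h
  have q33 : P 3 3 := by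
    simp only [P, hD, quad, Matrix.cons_val]; push_cast
    linear_combination (1 + x 0 ^ 3) * h33
  have q34 : P 3 4 := by
    simp only [P, hD, quad, Matrix.cons_val]; push_cast
    linear_combination (1 + x 0 ^ 3) * h34 + h
  have q35 : P 3 5 := by
    simp only [P, hD, quad, Matrix.cons_val]; push_cast
    linear_combination (1 + x 0 ^ 3) * h35
  have q36 : P 3 6 := by
    simp only [P, hD, quad, Matrix.cons_val]; push_cast
    linear_combination (1 + x 0 ^ 3) * h36 + h
  have q44 : P 4 4 := by
    simp only [P, hD, quad, Matrix.cons_val]; push_cast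
    linear_combination (1 + x 0 ^ 3) * h44 + 2 * h
  have q45 : P 4 5 := by
    simp only [P, hD, quad, Matrix.cons_val]; push_cast
    linear_combination (1 + x 0 ^ 3) * h45 + h
  have q46 : P 4 6 := by
    simp only [P, hD, quad, Matrix.cons_val]; push_cast
    linear_combination (1 + x 0 ^ 3) * h46
  have q55 : P 5 5 := by
    simp only [P, hD, quad, Matrix.cons_val]; push_cast
    linear_combination (1 + x 0 ^ 3) * h55 + h
  have q56 : P 5 6 := by
    simp only [P, hD, quad, Matrix.cons_val]; push_cast
    linear_combination (1 + x 0 ^ 3) * h56 - h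
  have q66 : P 6 6 := by
    simp only [P, hD, quad, Matrix.cons_val]; push_cast
    linear_combination (1 + x 0 ^ 3) * h66 - 3 * h
  have hP : ∀ i j, P i j := by
    have h00 := hw 0
    have h01 := hw 1
    have h02 := hw 2
    have h03 := hw 3
    have h11 := hw 4
    have h12 := hw 5
    have h22 := hw 6
    intro i j
    fin_cases i <;> fin_cases j <;> first | assumption | exact hcomm (by assumption)
  have hq : ∀ i j, (1 + x 0 ^ 3) * x i * ((1 + x 0 ^ 3) * x j) = ∑ s, quad i j s •
      ((1 + x 0 ^ 3) * x (wFst s) * ((1 + x 0 ^ 3) * x (wSnd s))) := fun i j => by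
    simp only [hmul]
    exact hP i j
  refine ⟨⟨he, fun i => by linear_combination x i * he, hq, fun l s => ?_⟩, fun i => ?_⟩
  · refine x_mul_w_eq_zero (x := fun i => (1 + x 0 ^ 3) * x i) hq ?_ ?_ ?_ ?_ ?_ ?_ ?_ ?_ ?_ ?_ ?_
      l s <;> rw [hmul3]
    · linear_combination h
    · linear_combination (1 + x 0 ^ 3) * h001 - 3 * h
    · linear_combination (1 + x 0 ^ 3) * h002 + h
    · linear_combination (1 + x 0 ^ 3) * h003 - 3 * h
    · linear_combination (1 + x 0 ^ 3) * h011 + 9 * h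
    · linear_combination (1 + x 0 ^ 3) * h012 - 3 * h
    · linear_combination (1 + x 0 ^ 3) * h022 + h
    · linear_combination (1 + x 0 ^ 3) * h111 - 27 * h
    · linear_combination (1 + x 0 ^ 3) * h112 + 9 * h
    · linear_combination (1 + x 0 ^ 3) * h122 - 3 * h
    · linear_combination (1 + x 0 ^ 3) * h222 + h
  · fin_cases i
    exacts [ha (-1) 0 (by simpa using a0), ha 3 1 (by simpa using a1),
      ha (-1) 2 (by simpa using a2),
      ha 3 3 (by simpa using a3), ha 19 4 (by simpa using a4), ha (-22) 5 (by simpa using a5),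
      ha (-12) 6 (by simpa using a6)]

/-- The elements `x i` of `B` satisfy, up to multiples of `t ^ k`, relations lifting those of the
local component, and they lie in the component of `e` up to multiples of `t ^ N`. -/
structure IsLift {B : Type*} [CommRing B] (t e : B) (N k : ℕ) (x : Fin 7 → B)
    (q : Fin 7 → Fin 7 → Fin 7 → B) : Prop where
  comm : ∀ i j s, q i j s = q j i s
  q_w : ∀ s r, q (wFst s) (wSnd s) r = if s = r then 1 else 0
  e_mul_x : ∀ i, t ^ N ∣ e * x i - x i
  x_mul_x : ∀ i j, t ^ k ∣ x i * x j - ∑ s, q i j s * (x (wFst s) * x (wSnd s))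
  x_mul_w : ∀ l s, t ^ k ∣ x l * (x (wFst s) * x (wSnd s))

/-- A translation by multiples of `τ` turns obstructions divisible by `τ` into ones that vanish
modulo `J`, provided that `τ` kills the error terms modulo `J`. -/
theorem mul_sub_sum_mem_of_transl {B : Type*} [CommRing B] {J : Ideal B} {τ e : B}
    {x a : Fin 7 → B} {y : B} {q b : Fin 7 → B} {i j : Fin 7} (hττ : τ * τ ∈ J)
    (he : ∀ k, τ * (e * x k - x k) ∈ J)
    (hy : x i * x j - ∑ s, q s * (x (wFst s) * x (wSnd s)) = τ * y)
    (h : τ * (y - (∑ s, b s * (x (wFst s) * x (wSnd s)) + (a i * x j + a j * x i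
      - ∑ s, q s * (a (wFst s) * x (wSnd s) + a (wSnd s) * x (wFst s))))) ∈ J) :
    (x i - τ * a i * e) * (x j - τ * a j * e) - ∑ s, (q s + τ * b s) *
      ((x (wFst s) - τ * a (wFst s) * e) * (x (wSnd s) - τ * a (wSnd s) * e)) ∈ J := by
  rw [← Ideal.Quotient.eq_zero_iff_mem] at hττ h ⊢
  simp only [← Ideal.Quotient.eq_zero_iff_mem] at he
  replace hy := congrArg (Ideal.Quotient.mk J) hy
  simp only [map_mul, map_sub, map_add, map_sum] at hττ he hy h ⊢
  generalize Ideal.Quotient.mk J = φ at *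
  have hsum : ∑ s, (φ (q s) + φ τ * φ (b s)) * ((φ (x (wFst s)) - φ τ * φ (a (wFst s)) * φ e) *
      (φ (x (wSnd s)) - φ τ * φ (a (wSnd s)) * φ e)) =
      ∑ s, φ (q s) * (φ (x (wFst s)) * φ (x (wSnd s)))
      + φ τ * ∑ s, φ (b s) * (φ (x (wFst s)) * φ (x (wSnd s)))
      - φ τ * ∑ s, φ (q s) * (φ (a (wFst s)) * φ (x (wSnd s))
        + φ (a (wSnd s)) * φ (x (wFst s))) := by
    simp only [Finset.mul_sum, ← Finset.sum_add_distrib, ← Finset.sum_sub_distrib]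
    refine Finset.sum_congr rfl fun s _ => ?_
    have h₁ := he (wFst s)
    have h₂ := he (wSnd s)
    linear_combination (-φ (q s) * φ (a (wFst s))) * h₂ - φ (q s) * φ (a (wSnd s)) * h₁
      + (φ (q s) * φ (a (wFst s)) * φ (a (wSnd s)) * φ e ^ 2
        + φ (b s) * (φ τ * φ (a (wFst s)) * φ (a (wSnd s)) * φ e ^ 2
          - φ (a (wFst s)) * φ e * φ (x (wSnd s)) - φ (a (wSnd s)) * φ e * φ (x (wFst s)))) * hττ
  rw [hsum]
  linear_combination hy + h - φ (a i) * he j - φ (a j) * he i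
    + φ (a i) * φ (a j) * φ e ^ 2 * hττ

theorem mul_mul_mem_of_transl {B : Type*} [CommRing B] {J : Ideal B} {τ e x₁ x₂ x₃ z : B}
    (a₁ a₂ a₃ : B) (hττ : τ * τ ∈ J) (h₁ : τ * (e * x₁ - x₁) ∈ J) (h₂ : τ * (e * x₂ - x₂) ∈ J)
    (hz : x₁ * (x₂ * x₃) = τ * z)
    (h : τ * (z - (a₁ * (x₂ * x₃) + a₂ * (x₁ * x₃) + a₃ * (x₁ * x₂))) ∈ J) :
    (x₁ - τ * a₁ * e) * ((x₂ - τ * a₂ * e) * (x₃ - τ * a₃ * e)) ∈ J := by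
  rw [← Ideal.Quotient.eq_zero_iff_mem] at hττ h h₁ h₂ ⊢
  replace hz := congrArg (Ideal.Quotient.mk J) hz
  simp only [map_mul, map_sub, map_add] at hττ h₁ h₂ hz h ⊢
  generalize Ideal.Quotient.mk J = φ at *
  linear_combination hz + h - φ a₁ * φ x₃ * h₂ - φ a₂ * φ x₃ * h₁ - φ a₃ * φ x₂ * h₁
    + φ e ^ 2 * (φ a₁ * φ a₂ * φ x₃ + φ a₁ * φ a₃ * φ x₂ + φ a₂ * φ a₃ * φ x₁
      - φ τ * φ a₁ * φ a₂ * φ a₃ * φ e) * hττ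

section Lift

variable {K A B : Type*} [Field K] [CommRing A] [Algebra K A] [CommRing B] [Algebra K B]
  {π : B →ₐ[K] A} {t e : B} {X : Fin 7 → A}

/-- Since first-order deformations are translations, a lift to order `k` can be modified into a
lift to order `k + 1`. -/
theorem IsLift.exists_succ [CharZero K] (F : LocalCoords K A (π e) X)
    (ht : t ∈ nonZeroDivisors B) (hπ : ∀ b, π b = 0 ↔ t ∣ b) {N k : ℕ}
    (he : t ^ N ∣ e * e - e) (hk : 1 ≤ k) (hkN : k < N) {x : Fin 7 → B}
    {q : Fin 7 → Fin 7 → Fin 7 → B} (h : IsLift t e N k x q) (hx : ∀ i, π (x i) = X i)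
    (hq : ∀ i j s, π (q i j s) = quad i j s) :
    ∃ x' q', IsLift t e N (k + 1) x' q' ∧ (∀ i, π (x' i) = X i) ∧
      ∀ i j s, π (q' i j s) = quad i j s := by
  obtain rfl : (fun i => π (x i)) = X := funext hx
  have hcancel : ∀ a b : B, t ^ k * a = t ^ k * b → a = b := fun a b hab =>
    (mul_cancel_left_mem_nonZeroDivisors (pow_mem ht k)).1 hab
  have hdvd : ∀ a : B, t ^ N ∣ t ^ k * a → π a = 0 := by
    rintro a ⟨c, hc⟩
    refine (hπ a).2 ⟨t ^ (N - k - 1) * c, hcancel _ _ ?_⟩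
    rw [hc, ← mul_assoc, ← mul_assoc, ← pow_succ, ← pow_add]
    congr 2
    omega
  choose y hy using h.x_mul_x
  choose z hz using h.x_mul_w
  have hπt : π t = 0 := (hπ t).2 dvd_rfl
  have hex : ∀ i c, t ^ N ∣ e * (x i * c) - x i * c := fun i c => by
    rw [← mul_assoc, ← sub_mul]
    exact (h.e_mul_x i).mul_right c
  have hye : ∀ i j, π e * π (y i j) = π (y i j) := fun i j => by
    rw [← sub_eq_zero, ← map_mul, ← map_sub]
    apply hdvd
    rw [mul_sub, mul_left_comm, ← hy, mul_sub, Finset.mul_sum, sub_sub_sub_comm,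
      ← Finset.sum_sub_distrib]
    refine dvd_sub (hex _ _) (Finset.dvd_sum fun s _ => ?_)
    rw [mul_left_comm e, ← mul_sub]
    exact (hex _ _).mul_left _
  have hze : ∀ l s, π e * π (z l s) = π (z l s) := fun l s => by
    rw [← sub_eq_zero, ← map_mul, ← map_sub]
    apply hdvd
    rw [mul_sub, mul_left_comm, ← hz]
    exact hex _ _
  have hcomm : ∀ i j, y i j = y j i := fun i j => hcancel _ _ (by
    rw [← hy, ← hy, mul_comm]; simp only [h.comm])
  have hw : ∀ s, y (wFst s) (wSnd s) = 0 := fun s => hcancel _ _ (by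
    rw [← hy]; simp [h.q_w])
  have hassoc' : ∀ l i j, x l * (x i * x j) =
      t ^ k * (∑ s, q i j s * z l s + x l * y i j) := fun l i j => by
    have : ∑ s, q i j s * (t ^ k * z l s) = x l * ∑ s, q i j s * (x (wFst s) * x (wSnd s)) := by
      simp only [Finset.mul_sum, ← hz, mul_left_comm (x l)]
    simp only [mul_left_comm (q _ _ _) (t ^ k), ← Finset.mul_sum] at this
    linear_combination x l * hy i j - this
  have hassoc : ∀ l i j, ∑ s, quad i j s • π (z l s) + π (x l) * π (y i j)
      = ∑ s, quad l i s • π (z j s) + π (x j) * π (y l i) := fun l i j => by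
    have := congrArg π (hcancel _ _ ((hassoc' l i j).symm.trans
      ((by ring : x l * (x i * x j) = x j * (x l * x i)).trans (hassoc' j l i))))
    simpa only [map_add, map_mul, map_sum, hq, ← zsmul_eq_mul] using this
  obtain ⟨a, b, hbc, hbw, hya, hza⟩ := F.exists_eq_transl hye hze
    (fun i j => by rw [hcomm]) (fun s => by rw [hw, map_zero]) hassoc
  have hττ : t ^ k * t ^ k ∈ Ideal.span {t ^ (k + 1)} := by
    rw [Ideal.mem_span_singleton, ← pow_add]
    exact pow_dvd_pow _ (by omega)
  have hmem : ∀ c, π c = 0 → t ^ k * c ∈ Ideal.span {t ^ (k + 1)} := fun c hc => by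
    rw [Ideal.mem_span_singleton, pow_succ]
    exact mul_dvd_mul_left _ ((hπ c).1 hc)
  have hemem : ∀ i, t ^ k * (e * x i - x i) ∈ Ideal.span {t ^ (k + 1)} := fun i =>
    hmem _ (by simpa using sub_eq_zero.2 (F.e_mul_x i))
  have hπtk : π (t ^ k) = 0 := by rw [map_pow, hπt, zero_pow (by omega)]
  refine ⟨fun i => x i - t ^ k * algebraMap K B (a i) * e,
    fun i j s => q i j s + t ^ k * algebraMap K B (b i j s),
    ⟨fun i j s => by rw [h.comm, hbc], fun s r => by rw [h.q_w, hbw]; simp, fun i => ?_,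
      fun i j => ?_, fun l s => ?_⟩, fun i => ?_, fun i j s => ?_⟩
  · have : e * (x i - t ^ k * algebraMap K B (a i) * e) - (x i - t ^ k * algebraMap K B (a i) * e)
        = (e * x i - x i) - t ^ k * algebraMap K B (a i) * (e * e - e) := by ring
    rw [this]
    exact dvd_sub (h.e_mul_x i) (he.mul_left _)
  · rw [← Ideal.mem_span_singleton]
    refine mul_sub_sum_mem_of_transl (a := fun i => algebraMap K B (a i)) hττ hemem (hy i j)
      (hmem _ ?_)
    rw [map_sub, sub_eq_zero, hya]
    simp [LocalCoords.transl, Algebra.smul_def, hq]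
  · rw [← Ideal.mem_span_singleton]
    refine mul_mul_mem_of_transl _ _ _ hττ (hemem _) (hemem _) (hz l s) (hmem _ ?_)
    rw [map_sub, sub_eq_zero, hza]
    simp [LocalCoords.translW, Algebra.smul_def]
  · simp [hπtk]
  · simp [hπtk, hq]

/-- The relations of the local component can be lifted to any order. -/
theorem exists_isLift [CharZero K] (F : LocalCoords K A (π e) X)
    (ht : t ∈ nonZeroDivisors B) (hπ : ∀ b, π b = 0 ↔ t ∣ b) (hsurj : Function.Surjective π)
    {N : ℕ} (he : t ^ N ∣ e * e - e) (hN : 1 ≤ N) :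
    ∃ x q, IsLift t e N N x q ∧ ∀ i, π (x i) = X i := by
  have key : ∀ k, 1 ≤ k → k ≤ N → ∃ x q, IsLift t e N k x q ∧ (∀ i, π (x i) = X i) ∧
      ∀ i j s, π (q i j s) = quad i j s := by
    intro k hk
    induction k, hk using Nat.le_induction with
    | base =>
      intro _
      choose x hx using fun i => hsurj (X i)
      have hx' : ∀ i, π (e * x i) = X i := fun i => by rw [map_mul, hx, F.e_mul_x]
      refine ⟨fun i => e * x i, fun i j s => quad i j s,
        ⟨fun i j s => by rw [quad_comm], fun s r => by rw [quad_wFst_wSnd]; simp, fun i => ?_,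
          fun i j => ?_, fun l s => ?_⟩, hx', fun i j s => map_intCast π _⟩
      · rw [← mul_assoc, ← sub_mul]
        exact he.mul_right _
      · rw [pow_one, ← hπ]
        simp only [map_sub, map_sum, map_mul π (_ * _), hx', map_mul π (Int.cast _), map_intCast]
        simp [F.x_mul_x i j]
      · rw [pow_one, ← hπ]
        simp only [map_mul π (_ * _), hx']
        exact F.x_mul_w l s
    | succ k hk ih =>
      intro hkN
      obtain ⟨x, q, h, hx, hq⟩ := ih (by omega)
      exact h.exists_succ F ht hπ he hk hkN hx hq
  obtain ⟨x, q, h, hx, -⟩ := key N hN le_rfl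
  exact ⟨x, q, h, hx⟩

end Lift

/-- The family consisting of `1 - e`, `e`, the `x i` and the products `x (wFst s) * x (wSnd s)`. -/
def frame {A : Type*} [CommRing A] (e : A) (x : Fin 7 → A) : Bool ⊕ Fin 7 ⊕ Fin 7 → A :=
  Sum.elim (fun c => bif c then e else 1 - e) (Sum.elim x fun s => x (wFst s) * x (wSnd s))

theorem map_frame {A B : Type*} [CommRing A] [CommRing B] (f : B →+* A) (e : B) (x : Fin 7 → B) :
    f ∘ frame e x = frame (f e) fun i => f (x i) := by
  funext i
  rcases i with (_ | _) | _ | _ <;> simp [frame]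

namespace IsLocalModel

variable {K A : Type*} [Field K] [CommRing A] [Algebra K A] {e : A} {x : Fin 7 → A}

theorem e_mul_w (h : IsLocalModel e x) (s : Fin 7) :
    e * (x (wFst s) * x (wSnd s)) = x (wFst s) * x (wSnd s) := by
  rw [← mul_assoc, h.e_mul_x]

theorem top_le_span_frame (h : IsLocalModel e x) {x' : Fin 7 → A} (hx : ∀ i, x i = e * x' i)
    (hc : ∀ i, ∃ c : K, x' i * (1 - e) = c • (1 - e)) (hgen : Algebra.adjoin K (Set.range x') = ⊤) :
    ⊤ ≤ Submodule.span K (Set.range (frame e x)) := by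
  have hmem : ∀ i, frame e x i ∈ Submodule.span K (Set.range (frame e x)) := fun i =>
    Submodule.subset_span ⟨i, rfl⟩
  have hfalse := hmem (.inl false)
  have htrue := hmem (.inl true)
  have hxm := fun i => hmem (.inr (.inl i))
  have hwm := fun i => hmem (.inr (.inr i))
  simp only [frame, cond_false, cond_true, Sum.elim_inl, Sum.elim_inr] at hfalse htrue hxm hwm
  have hone : (1 : A) ∈ Submodule.span K (Set.range (frame e x)) := by
    have := add_mem htrue hfalse
    rwa [add_sub_cancel] at this
  have hx' : ∀ i j, x' i * x j = x i * x j := fun i j => by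
    linear_combination (-x' i) * h.e_mul_x j - x j * hx i
  have hmul : ∀ i, ∀ a ∈ Submodule.span K (Set.range (frame e x)),
      x' i * a ∈ Submodule.span K (Set.range (frame e x)) := by
    intro i a ha
    induction ha using Submodule.span_induction with
    | zero => simp
    | add a b _ _ ha hb => rw [mul_add]; exact add_mem ha hb
    | smul c a _ ha => rw [mul_smul_comm]; exact Submodule.smul_mem _ _ ha
    | mem a ha =>
      obtain ⟨(_ | _) | j | s, rfl⟩ := ha <;>
        simp only [frame, cond_false, cond_true, Sum.elim_inl, Sum.elim_inr]
      · obtain ⟨c, hc⟩ := hc i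
        rw [hc]
        exact Submodule.smul_mem _ _ hfalse
      · rw [mul_comm, ← hx]
        exact hxm i
      · rw [hx', h.x_mul_x]
        exact sum_mem fun s _ => zsmul_mem (hwm s) _
      · rw [← mul_assoc, hx', mul_assoc, h.x_mul_w]
        exact zero_mem _
  rintro a -
  have ha : a ∈ Algebra.adjoin K (Set.range x') := hgen ▸ Algebra.mem_top
  have : ∀ b ∈ Submodule.span K (Set.range (frame e x)),
      a * b ∈ Submodule.span K (Set.range (frame e x)) := by
    induction ha using Algebra.adjoin_induction with
    | mem a ha => obtain ⟨i, rfl⟩ := ha; exact hmul i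
    | algebraMap r =>
      intro b hb
      rw [← Algebra.smul_def]
      exact Submodule.smul_mem _ _ hb
    | add a a' _ _ h h' => intro b hb; rw [add_mul]; exact add_mem (h b hb) (h' b hb)
    | mul a a' _ _ h h' => intro b hb; rw [mul_assoc]; exact h _ (h' b hb)
  simpa using this 1 hone

/-- The coordinates attached to a basis of the form `frame e x`. -/
noncomputable def localCoords (h : IsLocalModel e x)
    (b : Module.Basis (Bool ⊕ Fin 7 ⊕ Fin 7) K A) (hb : ⇑b = frame e x) :
    LocalCoords K A e x := by
  have h₀ : 1 - e = b (.inl false) := by simp [hb, frame]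
  have h₁ : e = b (.inl true) := by simp [hb, frame]
  have h₂ : ∀ i, x i = b (.inr (.inl i)) := by simp [hb, frame]
  have h₃ : ∀ s, x (wFst s) * x (wSnd s) = b (.inr (.inr s)) := by simp [hb, frame]
  have hxe : ∀ i, x i * b (.inl true) = b (.inr (.inl i)) := fun i => by
    rw [← h₁, mul_comm, h.e_mul_x, h₂]
  have hx0 : ∀ i, x i * b (.inl false) = 0 := fun i => by
    rw [← h₀, mul_sub, mul_one, mul_comm, h.e_mul_x, sub_self]
  have hxx : ∀ i j, x i * b (.inr (.inl j)) = ∑ s, quad i j s • b (.inr (.inr s)) := fun i j => by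
    rw [← h₂, h.x_mul_x]
    simp only [h₃]
  have hxw : ∀ i s, x i * b (.inr (.inr s)) = 0 := fun i s => by rw [← h₃, h.x_mul_w]
  exact
  { ε := b.coord (.inl true)
    ξ := fun i => b.coord (.inr (.inl i))
    ω := fun s => b.coord (.inr (.inr s))
    e_mul_x := h.e_mul_x
    x_mul_x := h.x_mul_x
    x_mul_w := h.x_mul_w
    ε_e := by simp [h₁]
    ξ_e := by simp [h₁]
    ε_x_mul := fun l => by
      refine LinearMap.congr_fun (f := b.coord (.inl true) ∘ₗ LinearMap.mulLeft K (x l)) (g := 0)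
        (b.ext ?_)
      rintro ((_ | _) | i | s) <;> simp [hxe, hx0, hxx, hxw, -zsmul_eq_mul]
    ξ_x_mul := fun k l => by
      have : b.coord (.inr (.inl k)) ∘ₗ LinearMap.mulLeft K (x l) =
          if k = l then b.coord (.inl true) else 0 := b.ext ?_
      · intro a
        refine (LinearMap.congr_fun this a).trans ?_
        split_ifs <;> rfl
      · rcases eq_or_ne k l with rfl | hkl
        · rintro ((_ | _) | i | s) <;> simp [hxe, hx0, hxx, hxw, -zsmul_eq_mul]
        · rintro ((_ | _) | i | s) <;> simp [hxe, hx0, hxx, hxw, hkl, -zsmul_eq_mul]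
    ω_x_mul := fun s l => by
      have : b.coord (.inr (.inr s)) ∘ₗ LinearMap.mulLeft K (x l) =
          ∑ k, quad l k s • b.coord (.inr (.inl k)) := b.ext ?_
      · intro a
        refine (LinearMap.congr_fun this a).trans ?_
        simp [-zsmul_eq_mul]
      · rintro ((_ | _) | i | s) <;>
          simp [hxe, hx0, hxx, hxw, Finsupp.single_apply, -zsmul_eq_mul]
    eq_sum := fun a ha => by
      have hr := b.sum_repr a
      simp only [Fintype.sum_sum_type, Fintype.sum_bool, ← h₀, ← h₁, ← h₂, ← h₃] at hr
      have := congrArg (e * ·) hr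
      simp only [mul_add, mul_smul_comm, Finset.mul_sum, h.e_mul_x, h.e_mul_w, h.e_mul_e, ha,
        mul_sub, mul_one, sub_self, smul_zero, add_zero] at this
      simp only [Module.Basis.coord_apply]
      rw [add_assoc]
      exact this.symm }

end IsLocalModel

section Lift

open scoped PowerSeries

variable {K A B : Type*} [Field K] [CommRing A] [Algebra K A] [CommRing B] [Algebra K B]
  [Algebra K⟦X⟧ B] [IsScalarTower K K⟦X⟧ B] {π : B →ₐ[K] A}

/-- Lifts of a spanning family modulo `X` form a spanning family, by Nakayama's lemma. -/
theorem top_le_span_of_lift [Module.Finite K⟦X⟧ B]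
    (hπ : ∀ b, π b = 0 ↔ algebraMap K⟦X⟧ B PowerSeries.X ∣ b) {ι : Type*} [Fintype ι] {f : ι → B}
    (hf : ⊤ ≤ Submodule.span K (Set.range (π ∘ f))) : ⊤ ≤ Submodule.span K⟦X⟧ (Set.range f) := by
  refine Submodule.le_of_le_smul_of_le_jacobson_bot (I := Ideal.span {PowerSeries.X})
    Module.Finite.fg_top ?_ fun b _ => ?_
  · rw [IsLocalRing.jacobson_eq_maximalIdeal _ bot_ne_top, PowerSeries.maximalIdeal_eq_span_X]
  · obtain ⟨c, hc⟩ := (Submodule.mem_span_range_iff_exists_fun K).1 (hf (x := π b) trivial)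
    have : π (b - ∑ i, c i • f i) = 0 := by
      simp only [map_sub, map_sum, map_smul, ← hc, Function.comp_apply, sub_self]
    obtain ⟨r, hr⟩ := (hπ _).1 this
    rw [sub_eq_iff_eq_add', ← Algebra.smul_def] at hr
    rw [hr]
    refine add_mem (Submodule.mem_sup_left (sum_mem fun i _ => ?_)) (Submodule.mem_sup_right ?_)
    · rw [← algebraMap_smul K⟦X⟧ (c i)]
      exact Submodule.smul_mem _ _ (Submodule.subset_span ⟨i, rfl⟩)
    · exact Submodule.smul_mem_smul (Ideal.mem_span_singleton_self _) trivial

/-- A linearly independent family spanning modulo `X` remains independent modulo `X`. -/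
theorem linearIndependent_of_basis (hπ : ∀ b, π b = 0 ↔ algebraMap K⟦X⟧ B PowerSeries.X ∣ b)
    {ι : Type*} [Fintype ι] (β : Module.Basis ι K⟦X⟧ B) : LinearIndependent K (π ∘ β) := by
  rw [Fintype.linearIndependent_iff]
  intro c hc i
  have : π (∑ i, c i • β i) = 0 := by simpa using hc
  obtain ⟨r, hr⟩ := (hπ _).1 this
  have h := congrArg (fun b => PowerSeries.constantCoeff (β.repr b i)) hr
  simpa only [← algebraMap_smul K⟦X⟧ (c _), ← Algebra.smul_def, β.repr_sum_self, map_smul,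
    Finsupp.smul_apply, smul_eq_mul, map_mul, PowerSeries.constantCoeff_X, zero_mul,
    PowerSeries.algebraMap_eq, PowerSeries.constantCoeff_C] using h

end Lift

/-- If `x (wFst 0) * x (wSnd 0)` is annihilated modulo `r` by all members of the basis `frame e x`
other than `e`, then `r` divides the discriminant of that basis. -/
theorem dvd_discr_of_coe_eq_frame {R B : Type*} [CommRing R] [CommRing B] [Algebra R B] {r : R}
    {e : B} {x : Fin 7 → B} (β : Module.Basis (Bool ⊕ Fin 7 ⊕ Fin 7) R B) (hβ : ⇑β = frame e x)
    (hx : ∀ i, algebraMap R B r ∣ e * x i - x i)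
    (hw : ∀ l s, algebraMap R B r ∣ x l * (x (wFst s) * x (wSnd s))) :
    r ∣ Algebra.discr R β := by
  have hrepr : ∀ c i, algebraMap R B r ∣ c → r ∣ β.repr c i := by
    rintro _ i ⟨c, rfl⟩
    exact ⟨β.repr c i, by simp [← Algebra.smul_def]⟩
  set w := x (wFst 0) * x (wSnd 0) with hwdef
  have hwe : algebraMap R B r ∣ w * e - w := by
    have : w * e - w = x (wSnd 0) * (e * x (wFst 0) - x (wFst 0)) := by rw [hwdef]; ring
    exact this ▸ (hx _).mul_left _
  have hwβ : ∀ i, i ≠ .inl true → algebraMap R B r ∣ w * β i := by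
    rintro ((_ | _) | l | s) hi <;> simp only [hβ, frame, cond_false, Sum.elim_inl, Sum.elim_inr]
    · rw [mul_sub, mul_one]
      exact (dvd_sub_comm).1 hwe
    · exact absurd rfl hi
    · rw [mul_comm]
      exact hw l 0
    · rw [mul_left_comm]
      exact (mul_comm (x (wSnd s)) w ▸ hw (wSnd s) 0).mul_left _
  have hrow : ∀ j, r ∣ Algebra.traceMatrix R β (.inr (.inr 0)) j := by
    intro j
    rw [Algebra.traceMatrix_apply, Algebra.traceForm_apply, Algebra.trace_eq_matrix_trace β,
      Matrix.trace]
    refine Finset.dvd_sum fun i _ => ?_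
    have hβ0 : β (.inr (.inr 0)) = w := by simp [hβ, frame, hwdef]
    rw [Matrix.diag_apply, Algebra.leftMulMatrix_eq_repr_mul, hβ0]
    by_cases hj : j = .inl true
    · by_cases hi : i = .inl true
      · subst hi hj
        have he : β (.inl true) = e := by simp [hβ, frame]
        have h : β.repr w (.inl true) = 0 := by simp [← hβ0]
        rw [← sub_zero (β.repr _ _), ← h, ← Finsupp.sub_apply, ← map_sub, he]
        refine hrepr _ _ ?_
        have : w * e * e - w = (w * e - w) * e + (w * e - w) := by ring
        exact this ▸ dvd_add (hwe.mul_right _) hwe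
      · refine hrepr _ _ ?_
        rw [mul_right_comm]
        exact (hwβ i hi).mul_right _
    · exact hrepr _ _ ((hwβ j hj).mul_right _)
  rw [Algebra.discr_def, Matrix.det_apply]
  refine Finset.dvd_sum fun σ _ => ?_
  rw [Units.smul_def, zsmul_eq_mul]
  refine Dvd.dvd.mul_left ?_ _
  refine dvd_trans ?_ (Finset.dvd_prod_of_mem _ (Finset.mem_univ (σ⁻¹ (.inr (.inr 0)))))
  simpa using hrow _

section Etale

open TensorProduct

/-- In an étale algebra over a field of characteristic zero, every nonzero element has a multiple
with nonzero trace. -/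
theorem exists_trace_mul_ne_zero {L S : Type*} [Field L] [CharZero L] [CommRing S] [Algebra L S]
    [Algebra.Etale L S] {c : S} (hc : c ≠ 0) : ∃ d, Algebra.trace L S (c * d) ≠ 0 := by
  have : Module.Finite L S := Algebra.FormallyUnramified.finite_of_free L S
  obtain ⟨I, _, F, _, _, f, -⟩ := (Algebra.Etale.iff_exists_algEquiv_prod L S).1 inferInstance
  classical
  obtain ⟨i, hi⟩ : ∃ i, f c i ≠ 0 := by
    by_contra! h
    exact hc (f.injective (by rw [map_zero]; exact funext h))
  refine ⟨f.symm (Pi.single i (f c i)⁻¹), fun h => ?_⟩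
  have hf : f (c * f.symm (Pi.single i (f c i)⁻¹)) = Pi.single i 1 := by
    rw [map_mul, AlgEquiv.apply_symm_apply]
    ext j
    rcases eq_or_ne j i with rfl | hj <;> simp [*]
  generalize c * f.symm (Pi.single i (f c i)⁻¹) = p at h hf
  have hp : p * p = p := f.injective (by rw [map_mul, hf, ← Pi.single_mul, mul_one])
  rw [Algebra.trace_apply, LinearMap.IsIdempotentElem.trace_eq_zero_iff
    (by rw [IsIdempotentElem, ← map_mul, hp])] at h
  have hp0 : p = 0 := by simpa using LinearMap.congr_fun h 1
  rw [hp0, map_zero] at hf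
  simpa using congrFun hf i

theorem discr_ne_zero_of_etale {L S ι : Type*} [Field L] [CharZero L] [CommRing S] [Algebra L S]
    [Algebra.Etale L S] [Fintype ι] [DecidableEq ι] (b : Module.Basis ι L S) :
    Algebra.discr L b ≠ 0 := by
  intro h
  obtain ⟨v, hv, hv0⟩ := Matrix.exists_mulVec_eq_zero_iff.2 h
  obtain ⟨d, hd⟩ := exists_trace_mul_ne_zero (L := L) (c := b.equivFun.symm v)
    (by rwa [Ne, LinearEquiv.map_eq_zero_iff])
  have key := Algebra.traceMatrix_of_basis_mulVec b (b.equivFun.symm v)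
  rw [LinearEquiv.apply_symm_apply, hv0] at key
  refine hd (LinearMap.congr_fun (f := Algebra.trace L S ∘ₗ LinearMap.mulLeft L _) (g := 0)
    (b.ext fun i => ?_) d)
  exact (congrFun key i).symm

theorem discr_ne_zero_of_etale_baseChange {R L B ι : Type*} [CommRing R] [Field L] [CharZero L]
    [CommRing B] [Algebra R L] [Algebra R B] [Algebra.Etale L (L ⊗[R] B)] [Fintype ι]
    [DecidableEq ι] (b : Module.Basis ι R B) : Algebra.discr R b ≠ 0 := by
  have : Module.Free R B := .of_basis b
  have : Module.Finite R B := .of_basis b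
  intro h
  refine discr_ne_zero_of_etale (Algebra.TensorProduct.basis L b) ?_
  have key : Algebra.traceMatrix L (Algebra.TensorProduct.basis L b) =
      (algebraMap R L).mapMatrix (Algebra.traceMatrix R b) := by
    ext i j
    simp only [Algebra.traceMatrix_apply, Algebra.traceForm_apply, RingHom.mapMatrix_apply,
      Matrix.map_apply, Algebra.TensorProduct.basis_apply, Algebra.TensorProduct.tmul_mul_tmul,
      mul_one, Algebra.trace_apply, ← LinearMap.trace_baseChange]
    congr 1
    ext; simp
  rw [Algebra.discr_def, key, ← RingHom.map_det, ← Algebra.discr_def, h, map_zero]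

end Etale

section Discriminant

open scoped PowerSeries

/-- Idempotents lift to approximate idempotents of any order. -/
theorem exists_pow_dvd_mul_self_sub {A B : Type*} [CommRing A] [CommRing B] {π : B →+* A} {t : B}
    (hπ : ∀ b, π b = 0 ↔ t ∣ b) (hsurj : Function.Surjective π) {e₀ : A} (he₀ : e₀ * e₀ = e₀)
    (N : ℕ) : ∃ e, π e = e₀ ∧ t ^ (N + 1) ∣ e * e - e := by
  induction N with
  | zero =>
    obtain ⟨e, rfl⟩ := hsurj e₀
    refine ⟨e, rfl, ?_⟩
    rw [zero_add, pow_one, ← hπ, map_sub, map_mul, he₀, sub_self]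
  | succ N ih =>
    obtain ⟨e, rfl, he⟩ := ih
    refine ⟨3 * (e * e) - 2 * (e * e * e), ?_, ?_⟩
    · simp only [map_sub, map_mul, map_ofNat, he₀]
      ring
    · have : (3 * (e * e) - 2 * (e * e * e)) * (3 * (e * e) - 2 * (e * e * e)) -
          (3 * (e * e) - 2 * (e * e * e)) =
          (e * e - e) * (e * e - e) * (4 * (e * e) - 4 * e - 3) := by ring
      rw [this]
      exact ((pow_dvd_pow t (by omega)).trans
        (pow_add t (N + 1) (N + 1) ▸ mul_dvd_mul he he)).mul_right _

variable {K A B : Type*} [Field K] [CommRing A] [Algebra K A] [CommRing B] [Algebra K B]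
  [Algebra K⟦X⟧ B] [IsScalarTower K K⟦X⟧ B] [Module.Finite K⟦X⟧ B]
  {π : B →ₐ[K] A} {e : A} {x : Fin 7 → A}

theorem exists_basis_eq_frame (hrank : Module.finrank K⟦X⟧ B = 16)
    (hπ : ∀ b, π b = 0 ↔ algebraMap K⟦X⟧ B PowerSeries.X ∣ b)
    (hspan : ⊤ ≤ Submodule.span K (Set.range (frame e x))) {e' : B} {x' : Fin 7 → B}
    (he : π e' = e) (hx : ∀ i, π (x' i) = x i) :
    ∃ β : Module.Basis (Bool ⊕ Fin 7 ⊕ Fin 7) K⟦X⟧ B, ⇑β = frame e' x' := by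
  obtain rfl : (fun i => π (x' i)) = x := funext hx
  subst he
  refine ⟨basisOfTopLeSpanOfCardEqFinrank (frame e' x') (top_le_span_of_lift hπ ?_)
    (hrank ▸ rfl), coe_basisOfTopLeSpanOfCardEqFinrank _ _ _⟩
  exact map_frame (π : B →+* A) e' x' ▸ hspan

/-- The bases of a flat deformation obtained by lifting `frame e x` have zero discriminant. -/
theorem exists_basis_discr_eq_zero [CharZero K] [Module.Free K⟦X⟧ B]
    (hrank : Module.finrank K⟦X⟧ B = 16)
    (hπ : ∀ b, π b = 0 ↔ algebraMap K⟦X⟧ B PowerSeries.X ∣ b) (hsurj : Function.Surjective π)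
    (h : IsLocalModel e x) (hspan : ⊤ ≤ Submodule.span K (Set.range (frame e x))) :
    ∃ β : Module.Basis (Bool ⊕ Fin 7 ⊕ Fin 7) K⟦X⟧ B, Algebra.discr K⟦X⟧ β = 0 := by
  obtain ⟨e₁, he₁⟩ := hsurj e
  choose x₁ hx₁ using fun i => hsurj (x i)
  obtain ⟨β, hβ⟩ := exists_basis_eq_frame hrank hπ hspan he₁ hx₁
  refine ⟨β, PowerSeries.ext fun N => ?_⟩
  have hmap : π ∘ frame e₁ x₁ = frame e x := by
    rw [← he₁, ← funext hx₁]
    exact map_frame (π : B →+* A) e₁ x₁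
  have hli : LinearIndependent K (frame e x) := by
    rw [← hmap, ← hβ]
    exact linearIndependent_of_basis hπ β
  let b := Module.Basis.mk hli hspan
  obtain ⟨e', rfl, he'⟩ := exists_pow_dvd_mul_self_sub (π := (π : B →+* A)) hπ hsurj h.e_mul_e N
  have ht : algebraMap K⟦X⟧ B PowerSeries.X ∈ nonZeroDivisors B := by
    rw [mem_nonZeroDivisors_iff_right]
    intro c hc
    rw [mul_comm, ← Algebra.smul_def] at hc
    exact (smul_eq_zero.1 hc).resolve_left PowerSeries.X_ne_zero
  obtain ⟨x', q, hlift, hx'⟩ := exists_isLift (h.localCoords b (Module.Basis.coe_mk _ _)) ht hπ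
    hsurj he' (by omega)
  obtain ⟨β', hβ'⟩ := exists_basis_eq_frame hrank hπ hspan (e' := e') rfl hx'
  have hdvd : PowerSeries.X ^ (N + 1) ∣ Algebra.discr K⟦X⟧ β' :=
    dvd_discr_of_coe_eq_frame β' hβ' (by simpa only [map_pow] using hlift.e_mul_x)
      (by simpa only [map_pow] using hlift.x_mul_w)
  have hdet := Algebra.discr_of_matrix_vecMul β' (β'.toMatrix β)
  rw [Module.Basis.toMatrix_map_vecMul] at hdet
  rw [map_zero]
  exact PowerSeries.X_pow_dvd_iff.1 (hdet ▸ hdvd.mul_left _) N N.lt_succ_self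

end Discriminant

/-- Over an algebraically closed field `K` of characteristic `0`, the `16`-dimensional
`K`-algebra `R/𝔞` is NOT smoothable. -/
theorem aIdeal_not_smoothable (K : Type) [Field K] [IsAlgClosed K] [CharZero K] :
    ∀ a : Ideal (MvPolynomial (Fin 7) K), a = Ideal.span (aGens K) →
      ¬ IsSmoothable K (MvPolynomial (Fin 7) K ⧸ a) 16 := by
  rintro a ha ⟨B, _, _, _, _, _, hrank, ⟨f⟩, _⟩
  have : Module.Finite (PowerSeries K) B := Module.finite_of_finrank_pos (by omega)
  let π : B →ₐ[K] MvPolynomial (Fin 7) K ⧸ a := f.toAlgHom.comp (Ideal.Quotient.mkₐ K _)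
  have hsurj : Function.Surjective π := f.surjective.comp Ideal.Quotient.mk_surjective
  have hπ : ∀ b, π b = 0 ↔ algebraMap (PowerSeries K) B PowerSeries.X ∣ b := fun b => by
    change f (Ideal.Quotient.mk _ b) = 0 ↔ _
    rw [map_eq_zero_iff f f.injective, Ideal.Quotient.eq_zero_iff_mem, Ideal.mem_span_singleton]
  let x : Fin 7 → MvPolynomial (Fin 7) K ⧸ a := fun i => Ideal.Quotient.mkₐ K a (X i)
  have haeval : aeval x = Ideal.Quotient.mkₐ K a := (aeval_unique _).symm
  obtain ⟨hmodel, hc⟩ := isLocalModel_of_aGens x fun p hp => by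
    rw [haeval]
    exact Ideal.Quotient.eq_zero_iff_mem.2 (ha ▸ Ideal.subset_span hp)
  have hgen : Algebra.adjoin K (Set.range x) = ⊤ := by
    rw [Algebra.adjoin_range_eq_range_aeval, haeval, AlgHom.range_eq_top]
    exact Ideal.Quotient.mkₐ_surjective K a
  obtain ⟨β, hβ⟩ := exists_basis_discr_eq_zero hrank hπ hsurj hmodel
    (hmodel.top_le_span_frame (fun _ => rfl) hc hgen)
  have : CharZero (LaurentSeries K) := charZero_of_injective_algebraMap
    (algebraMap K (LaurentSeries K)).injective
  exact discr_ne_zero_of_etale_baseChange (L := LaurentSeries K) β hβ
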